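/- arXiv:1008.3689 — 2 statements merged into one kernel-verified Lean document; each statement's English description precedes it below -/
import Mathlib

section
/- Let q be a prime power and 𝔽_q a finite field with q elements. Let X be a nonempty reduced separated scheme of finite type over 𝔽_q whose underlying topological space has Krull dimension d ∈ ℕ. For each integer v ≥ 1 let c_v be the (finite) number of 𝔽_q-scheme morphisms Spec 𝔽_{q^v} → X, where 𝔽_{q^v} denotes the field extension of 𝔽_q of degree v. Then the radius of convergence of the power series ∑_{v≥1} (c_v/v) t^v equals q^{−d}. -/
section

theorem zr_indep_frob {K F : Type*} [Field K] [Fintype K] [Field F] [Algebra K F]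
    (hInt : ∀ z : F, (∀ m₀ : ℕ, ∃ m ≥ m₀, ∃ w : F, w ^ (Fintype.card K ^ m) = z) →
      ∃ a : K, algebraMap K F a = z)
    (r : ℕ) : ∀ (e : Fin r → F) (_ : LinearIndependent K e),
    ∃ m₀ : ℕ, ∀ m ≥ m₀, ∀ g : Fin r → F,
      ∑ i, e i * g i ^ (Fintype.card K ^ m) = 0 → g = 0 := by
  have hsub : ∀ (m : ℕ) (a b : F), (a - b) ^ (Fintype.card K ^ m) =
      a ^ (Fintype.card K ^ m) - b ^ (Fintype.card K ^ m) := by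
    intro m a b
    have h := map_sub ((FiniteField.frobeniusAlgHom K F) ^ m) a b
    simpa [AlgHom.coe_pow, FiniteField.coe_frobeniusAlgHom, pow_iterate] using h
  have hq : Fintype.card K ≠ 0 := Fintype.card_ne_zero
  induction r with
  | zero => intro e _; exact ⟨0, fun m _ g _ => Subsingleton.elim _ _⟩
  | succ r ih =>
    intro e he
    obtain ⟨m₀, hm₀⟩ := ih (fun i => e i.succ) (he.comp _ (Fin.succ_injective _))
    by_contra! hcon
    have key : ∀ m₁ : ℕ, ∃ m ≥ m₁, ∃ h : Fin r → F,
        e 0 = ∑ i, e i.succ * h i ^ (Fintype.card K ^ m) := by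
      intro m₁
      obtain ⟨m, hm, g, hg, hg0⟩ := hcon (max m₀ m₁)
      refine ⟨m, le_trans (le_max_right _ _) hm, fun i => -(g i.succ / g 0), ?_⟩
      have hm' : m ≥ m₀ := le_trans (le_max_left _ _) hm
      have hpow0 : (0 : F) ^ (Fintype.card K ^ m) = 0 := zero_pow (pow_ne_zero _ hq)
      have hneg : ∀ a : F, (-a) ^ (Fintype.card K ^ m) = - a ^ (Fintype.card K ^ m) := by
        intro a
        have := hsub m 0 a
        rwa [hpow0, zero_sub, zero_sub] at this
      have hg00 : g 0 ≠ 0 := by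
        intro h0
        apply hg0
        rw [Fin.sum_univ_succ, h0, hpow0, mul_zero, zero_add] at hg
        have := hm₀ m hm' _ hg
        funext i
        refine Fin.cases h0 (fun j => ?_) i
        exact congrFun this j
      rw [Fin.sum_univ_succ] at hg
      have h1 : e 0 * g 0 ^ (Fintype.card K ^ m) =
          - ∑ i : Fin r, e i.succ * g i.succ ^ (Fintype.card K ^ m) :=
        eq_neg_of_add_eq_zero_left hg
      have h2 : g 0 ^ (Fintype.card K ^ m) ≠ 0 := pow_ne_zero _ hg00
      rw [eq_comm, ← mul_left_inj' h2, h1, Finset.sum_mul, ← Finset.sum_neg_distrib]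
      refine Finset.sum_congr rfl fun i _ => ?_
      rw [hneg, div_pow]
      field_simp
    obtain ⟨m₁, hm₁, h₁, hh₁⟩ := key m₀
    have hc : ∀ i, ∃ a : K, algebraMap K F a = h₁ i ^ (Fintype.card K ^ m₁) := by
      intro i
      apply hInt
      intro m₂
      obtain ⟨m, hm, h, hh⟩ := key (max m₁ m₂)
      refine ⟨m, le_trans (le_max_right _ _) hm, h i, ?_⟩
      obtain ⟨t, rfl⟩ := Nat.exists_eq_add_of_le (le_trans (le_max_left _ _) hm)
      have : (fun i => h₁ i - h i ^ (Fintype.card K ^ t)) = 0 := by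
        apply hm₀ m₁ hm₁
        simp only [hsub, mul_sub, Finset.sum_sub_distrib]
        rw [← hh₁, hh, sub_eq_zero]
        refine Finset.sum_congr rfl fun i _ => ?_
        rw [← pow_mul, ← pow_add, add_comm t]
      have h3 := congrFun this i
      simp only [Pi.zero_apply, sub_eq_zero] at h3
      rw [h3, ← pow_mul, ← pow_add, add_comm t]
    choose a ha using hc
    have : ∑ i, (Fin.cons (-1) a : Fin (r+1) → K) i • e i = 0 := by
      rw [Fin.sum_univ_succ]
      simp only [Fin.cons_zero, Fin.cons_succ, neg_smul, one_smul]
      rw [hh₁, neg_add_eq_zero]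
      refine Finset.sum_congr rfl fun i _ => ?_
      rw [Algebra.smul_def, ha, mul_comm]
    have := Fintype.linearIndependent_iff.1 he _ this 0
    simp at this

end

section

theorem zr_schwartz_zippel {L : Type*} [Field L] [Fintype L] (D : ℕ) (d : ℕ) :
    ∀ g : MvPolynomial (Fin d) L, g ≠ 0 → (∀ i, g.degreeOf i ≤ D) →
    (Fintype.card L - D) ^ d ≤ Nat.card {ξ : Fin d → L // MvPolynomial.eval ξ g ≠ 0} := by
  classical
  induction d with
  | zero =>
    intro g hg _
    rw [pow_zero]
    refine Nat.succ_le_of_lt (Nat.card_pos_iff.2 ?_)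
    refine ⟨⟨⟨Fin.elim0, ?_⟩⟩, inferInstance⟩
    obtain ⟨a, rfl⟩ := MvPolynomial.C_surjective (Fin 0) g
    simpa using hg
  | succ d ih =>
    intro g hg hdeg
    set G := MvPolynomial.finSuccEquiv L d g with hG
    have hG0 : G ≠ 0 := by simpa [hG] using hg
    have hlc : G.leadingCoeff ≠ 0 := by simpa using hG0
    have h1 := ih G.leadingCoeff hlc (fun i =>
      (MvPolynomial.degreeOf_coeff_finSuccEquiv g i _).trans (hdeg i.succ))
    have hnd : G.natDegree ≤ D := by
      rw [hG, MvPolynomial.natDegree_finSuccEquiv]; exact hdeg 0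
    have hfib : ∀ ξ : {ξ : Fin d → L // MvPolynomial.eval ξ G.leadingCoeff ≠ 0},
        Fintype.card L - D ≤
          Nat.card {a : L // (G.map (MvPolynomial.eval ξ.1)).eval a ≠ 0} := by
      rintro ⟨ξ, hξ⟩
      set p := G.map (MvPolynomial.eval ξ) with hp
      have hp0 : p ≠ 0 := by
        intro h
        apply hξ
        have := congrArg (fun r => Polynomial.coeff r G.natDegree) h
        simpa [hp] using this
      have hpd : p.natDegree ≤ D := (Polynomial.natDegree_map_le).trans hnd
      have hr : p.roots.toFinset.card ≤ D :=
        (Multiset.toFinset_card_le _).trans ((Polynomial.card_roots' p).trans hpd)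
      have : Nat.card {a : L // p.eval a ≠ 0} = (p.roots.toFinsetᶜ).card := by
        rw [Nat.card_eq_fintype_card, Fintype.card_subtype]
        congr 1
        ext a
        simp [hp0]
      rw [this, Finset.card_compl]
      omega
    let Φ : (Σ ξ : {ξ : Fin d → L // MvPolynomial.eval ξ G.leadingCoeff ≠ 0},
        {a : L // (G.map (MvPolynomial.eval ξ.1)).eval a ≠ 0}) →
        {ξ : Fin (d+1) → L // MvPolynomial.eval ξ g ≠ 0} :=
      fun x => ⟨Fin.cons x.2.1 x.1.1, by
        have := x.2.2
        rw [MvPolynomial.eval_eq_eval_mv_eval']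
        exact this⟩
    have hΦ : Function.Injective Φ := by
      rintro ⟨⟨ξ, h⟩, ⟨a, ha⟩⟩ ⟨⟨ξ', h'⟩, ⟨a', ha'⟩⟩ heq
      have h2 := congrArg Subtype.val heq
      simp only [Φ] at h2
      obtain ⟨rfl, rfl⟩ := Fin.cons_injective2 h2
      rfl
    refine le_trans ?_ (Nat.card_le_card_of_injective Φ hΦ)
    rw [Nat.card_sigma, pow_succ]
    calc _ ≤ Nat.card {ξ : Fin d → L // MvPolynomial.eval ξ G.leadingCoeff ≠ 0}
          * (Fintype.card L - D) := Nat.mul_le_mul_right _ h1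
      _ = ∑ ξ : {ξ : Fin d → L // MvPolynomial.eval ξ G.leadingCoeff ≠ 0},
          (Fintype.card L - D) := by
            rw [Finset.sum_const, smul_eq_mul, Finset.card_univ, Nat.card_eq_fintype_card]
      _ ≤ _ := Finset.sum_le_sum fun ξ _ => hfib ξ

end

section

open Polynomial

/-- The ring of pairs of distinct roots. -/
theorem zr_double {P : Type} [CommRing P] [Nontrivial P] (f : P[X]) (hf : f.Monic) :
    ∃ (S : Type) (_ : CommRing S) (_ : Algebra P S)
      (_ : Module.Basis (Fin f.natDegree × Fin (f.natDegree - 1)) P S) (y Y : S),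
      ∀ (Ω : Type) [Field Ω] (φ : P →+* Ω) (η η' : Ω), η ≠ η' →
        f.eval₂ φ η = 0 → f.eval₂ φ η' = 0 →
        ∃ ψ : S →+* Ω, ψ.comp (algebraMap P S) = φ ∧ ψ y = η ∧ ψ Y = η' := by
  by_cases hfd : f.natDegree = 0
  · have h1 : f = 1 := (Polynomial.Monic.natDegree_eq_zero hf).1 hfd
    subst h1
    have : IsEmpty (Fin (natDegree (1 : P[X])) × Fin (natDegree (1 : P[X]) - 1)) := by
      rw [natDegree_one]; infer_instance
    refine ⟨PUnit, inferInstance, inferInstance, Module.Basis.empty _, 0, 0, ?_⟩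
    intro Ω _ φ η η' _ h
    simp at h
  set R := AdjoinRoot f
  have : Nontrivial R := by
    have : Module.Free P R := hf.free_adjoinRoot
    have b := (AdjoinRoot.powerBasis' hf).basis
    have e : Nonempty (Fin (AdjoinRoot.powerBasis' hf).dim) := by
      rw [AdjoinRoot.powerBasis'_dim]
      exact ⟨⟨0, Nat.pos_of_ne_zero hfd⟩⟩
    exact b.repr.toEquiv.nontrivial
  set F : R[X] := f.map (AdjoinRoot.of f)
  have hF : F.Monic := hf.map _
  set f₁ : R[X] := F /ₘ (X - C (AdjoinRoot.root f))
  have hmul : (X - C (AdjoinRoot.root f)) * f₁ = F := by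
    rw [mul_divByMonic_eq_iff_isRoot, IsRoot, eval_map]
    exact AdjoinRoot.eval₂_root f
  have hf₁ : f₁.Monic := by
    have := hF
    rw [← hmul] at this
    exact (monic_X_sub_C _).of_mul_monic_left this
  have hnd : f₁.natDegree = f.natDegree - 1 := by
    have : F.natDegree = f.natDegree := hf.natDegree_map _
    rw [natDegree_divByMonic _ (monic_X_sub_C _), natDegree_X_sub_C, this]
  set S := AdjoinRoot f₁
  let b1 := (AdjoinRoot.powerBasis' hf).basis
  let b2 := (AdjoinRoot.powerBasis' hf₁).basis
  let b := (b1.smulTower b2).reindex (Equiv.prodCongr (finCongr (AdjoinRoot.powerBasis'_dim hf))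
    (finCongr ((AdjoinRoot.powerBasis'_dim hf₁).trans hnd)))
  refine ⟨S, inferInstance, inferInstance, b, AdjoinRoot.of f₁ (AdjoinRoot.root f),
    AdjoinRoot.root f₁, ?_⟩
  intro Ω _ φ η η' hne h h'
  let ψ₁ : R →+* Ω := AdjoinRoot.lift φ η h
  have hψof : ∀ a, ψ₁ (AdjoinRoot.of f a) = φ a := fun a => AdjoinRoot.lift_of h
  have hψroot : ψ₁ (AdjoinRoot.root f) = η := AdjoinRoot.lift_root h
  have hψ₁ : f₁.eval₂ ψ₁ η' = 0 := by
    have h3 : F.eval₂ ψ₁ η' = 0 := by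
      rw [eval₂_map]
      have : ψ₁.comp (AdjoinRoot.of f) = φ := by
        exact RingHom.ext hψof
      rw [this, h']
    rw [← hmul, eval₂_mul] at h3
    rcases mul_eq_zero.1 h3 with h4 | h4
    · exfalso
      simp only [eval₂_sub, eval₂_X, eval₂_C, hψroot, sub_eq_zero] at h4
      exact hne h4.symm
    · exact h4
  refine ⟨AdjoinRoot.lift ψ₁ η' hψ₁, ?_, ?_, ?_⟩
  · ext a
    have h5 : algebraMap P S a = AdjoinRoot.of f₁ (AdjoinRoot.of f a) := rfl
    rw [RingHom.comp_apply, h5, AdjoinRoot.lift_of hψ₁, hψof]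
  · rw [AdjoinRoot.lift_of hψ₁, hψroot]
  · exact AdjoinRoot.lift_root hψ₁

end

section

open Polynomial

def zrD {K : Type} [Field K] {d : ℕ} (D : ℕ) (p : MvPolynomial (Fin d) K) : Prop :=
  ∀ i, p.degreeOf i ≤ D

theorem zrD.mono {K : Type} [Field K] {d : ℕ} {D D' : ℕ} {p : MvPolynomial (Fin d) K}
    (h : zrD D p) (hD : D ≤ D') : zrD D' p := fun i => (h i).trans hD

theorem zrD.zero {K : Type} [Field K] {d : ℕ} {D : ℕ} :
    zrD D (0 : MvPolynomial (Fin d) K) := fun i => by simp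

theorem zrD.one {K : Type} [Field K] {d : ℕ} {D : ℕ} :
    zrD D (1 : MvPolynomial (Fin d) K) := fun i => by
  rw [← map_one MvPolynomial.C, MvPolynomial.degreeOf_C]; exact Nat.zero_le _

theorem zrD.add {K : Type} [Field K] {d : ℕ} {D : ℕ} {p p' : MvPolynomial (Fin d) K}
    (h : zrD D p) (h' : zrD D p') : zrD D (p + p') := fun i =>
  (MvPolynomial.degreeOf_add_le i p p').trans (max_le (h i) (h' i))

theorem zrD.neg {K : Type} [Field K] {d : ℕ} {D : ℕ} {p : MvPolynomial (Fin d) K}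
    (h : zrD D p) : zrD D (-p) := fun i => by
  rw [MvPolynomial.degreeOf_neg]; exact h i

theorem zrD.sub {K : Type} [Field K] {d : ℕ} {D : ℕ} {p p' : MvPolynomial (Fin d) K}
    (h : zrD D p) (h' : zrD D p') : zrD D (p - p') := by
  rw [sub_eq_add_neg]; exact h.add h'.neg

theorem zrD.mul {K : Type} [Field K] {d : ℕ} {D D' : ℕ} {p p' : MvPolynomial (Fin d) K}
    (h : zrD D p) (h' : zrD D' p') : zrD (D + D') (p * p') := fun i =>
  (MvPolynomial.degreeOf_mul_le i p p').trans (add_le_add (h i) (h' i))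

theorem zrD.smul {K : Type} [Field K] {d : ℕ} {D : ℕ} {p : MvPolynomial (Fin d) K}
    (h : zrD D p) (a : K) : zrD D (a • p) := by
  rw [MvPolynomial.smul_eq_C_mul]
  have : zrD 0 (MvPolynomial.C (σ := Fin d) a) := fun i => by simp
  simpa using this.mul h

theorem zrD.sum {K : Type} [Field K] {d : ℕ} {D : ℕ} {ι : Type*} (s : Finset ι)
    (p : ι → MvPolynomial (Fin d) K)
    (h : ∀ i ∈ s, zrD D (p i)) : zrD D (∑ i ∈ s, p i) := by
  classical
  induction s using Finset.induction_on with
  | empty => simpa using zrD.zero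
  | insert a s ha ih =>
    rw [Finset.sum_insert ha]
    exact (h a (by simp)).add (ih fun i hi => h i (by simp [hi]))

theorem zrD.exists {K : Type} [Field K] {d : ℕ} {ι : Type*} (s : Finset ι)
    (p : ι → MvPolynomial (Fin d) K) : ∃ D, ∀ i ∈ s, zrD D (p i) := by
  refine ⟨s.sup fun i => (p i).totalDegree, fun i hi j => ?_⟩
  exact (MvPolynomial.degreeOf_le_totalDegree _ _).trans
    (Finset.le_sup (f := fun i => (p i).totalDegree) hi)

noncomputable def zrMon (K : Type) [Field K] {d : ℕ} (t : Fin d → ℕ) : MvPolynomial (Fin d) K :=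
  MvPolynomial.monomial (Finsupp.equivFunOnFinite.symm t) 1

theorem zrMon_aeval {K : Type} [Field K] {d : ℕ} (t : Fin d → ℕ) {S : Type*} [CommRing S]
    [Algebra K S] (x : Fin d → S) : MvPolynomial.aeval x (zrMon K t) = ∏ i, x i ^ t i := by
  rw [zrMon, MvPolynomial.aeval_monomial, map_one, one_mul, Finsupp.prod_fintype]
  · rfl
  · simp

theorem zrMon_deg {K : Type} [Field K] {d : ℕ} (t : Fin d → ℕ) (D : ℕ) (h : ∀ i, t i ≤ D) :
    zrD D (zrMon K t) := fun i => by
  rw [zrMon, MvPolynomial.degreeOf_monomial_eq _ _ one_ne_zero]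
  exact h i

theorem zrMon_inj {K : Type} [Field K] {d : ℕ} {ι : Type*} [Fintype ι] (t : ι → Fin d → ℕ)
    (ht : Function.Injective t) (α : ι → K) (h : ∑ i, α i • zrMon K (t i) = 0) : α = 0 := by
  have hb := (MvPolynomial.basisMonomials (Fin d) K).linearIndependent
  have hb2 := hb.comp (fun i => Finsupp.equivFunOnFinite.symm (t i))
    (Finsupp.equivFunOnFinite.symm.injective.comp ht)
  funext i
  refine Fintype.linearIndependent_iff.1 hb2 α ?_ i
  simpa [zrMon] using h

/-- reduction of powers -/
theorem zr_reduce {K : Type} [Field K] {d : ℕ} (f : (MvPolynomial (Fin d) K)[X]) (hf : f.Monic)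
    (hn : 1 ≤ f.natDegree) (c : ℕ) (hc : ∀ k, zrD c (f.coeff k)) (N : ℕ) :
    ∃ r : (MvPolynomial (Fin d) K)[X], r.degree < f.natDegree ∧
      (∀ k, zrD (c * N) (r.coeff k)) ∧ f ∣ X ^ N - r := by
  induction N with
  | zero =>
    refine ⟨1, ?_, ?_, by simp⟩
    · rw [degree_one]; exact_mod_cast hn
    · intro k
      rw [coeff_one]
      split_ifs
      · exact zrD.one
      · exact zrD.zero
  | succ N ih =>
    obtain ⟨r, hr, hrc, hdvd⟩ := ih
    refine ⟨X * r - C (r.coeff (f.natDegree - 1)) * f, ?_, ?_, ?_⟩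
    · rw [degree_lt_iff_coeff_zero]
      intro m hm
      obtain ⟨m, rfl⟩ : ∃ m', m = m' + 1 := ⟨m - 1, by omega⟩
      rw [coeff_sub, coeff_X_mul, coeff_C_mul]
      rcases hm.eq_or_lt with h | h
      · rw [h, ← h, hf.coeff_natDegree]
        simp [h]
      · rw [coeff_eq_zero_of_natDegree_lt h, mul_zero, sub_zero]
        exact (degree_lt_iff_coeff_zero _ _).1 hr _ (by omega)
    · intro k
      rw [coeff_sub, coeff_C_mul]
      refine zrD.sub ?_ ((hrc _).mul (hc k))
      cases k with
      | zero => rw [coeff_X_mul_zero]; exact zrD.zero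
      | succ k => rw [coeff_X_mul]; exact (hrc k).mono (by gcongr; omega)
    · have : X ^ (N+1) - (X * r - C (r.coeff (f.natDegree - 1)) * f) =
        X * (X ^ N - r) + C (r.coeff (f.natDegree - 1)) * f := by ring
      rw [this]
      exact dvd_add (dvd_mul_of_dvd_right hdvd _) (dvd_mul_left _ _)

theorem zr_exists_A (N k M B c d : ℕ) (h : N * M ^ d < k * B ^ d) :
    ∃ A : ℕ, 1 ≤ A ∧ N * (M * A + c) ^ d < k * (A * B) ^ d := by
  have h1 : Filter.Tendsto (fun A : ℕ => (N : ℝ) * (M + c / (A : ℝ)) ^ d) Filter.atTop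
      (nhds (N * (M + 0) ^ d)) :=
    ((tendsto_const_nhds.add (tendsto_const_div_atTop_nhds_zero_nat _)).pow d).const_mul _
  have h2 : (N * (M + 0) ^ d : ℝ) < k * B ^ d := by
    rw [add_zero]; exact_mod_cast h
  obtain ⟨A, hA1, hA⟩ := ((h1.eventually_lt_const h2).and (Filter.eventually_ge_atTop 1)).exists
  refine ⟨A, hA, ?_⟩
  have hA0 : (0 : ℝ) < A := by exact_mod_cast hA
  have : (N : ℝ) * (M * A + c) ^ d < k * (A * B) ^ d := by
    have e1 : (M * A + c : ℝ) = (M + c / A) * A := by field_simp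
    rw [e1, mul_pow, mul_pow, ← mul_assoc, mul_comm ((A : ℝ) ^ d), ← mul_assoc]
    gcongr
  exact_mod_cast this

theorem zr_exists_M (q n c d : ℕ) (hq : 2 ≤ q) (hn : 1 ≤ n) :
    ∃ μ : ℕ, c < q ^ μ ∧ n * (n - 1) * (q ^ μ) ^ d < (n * n) * (q ^ μ - c) ^ d := by
  have h0 : Filter.Tendsto (fun μ : ℕ => q ^ μ) Filter.atTop Filter.atTop :=
    tendsto_pow_atTop_atTop_of_one_lt hq
  have h1 : Filter.Tendsto (fun M : ℕ => (n * n : ℝ) * (1 - c / (M : ℝ)) ^ d) Filter.atTop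
      (nhds ((n * n : ℝ) * (1 - 0) ^ d)) :=
    ((tendsto_const_nhds.sub (tendsto_const_div_atTop_nhds_zero_nat _)).pow d).const_mul _
  have h2 : (n * (n - 1 : ℕ) : ℝ) < (n * n : ℝ) * (1 - 0) ^ d := by
    rw [sub_zero, one_pow, mul_one]
    have : n * (n - 1) < n * n := by gcongr; omega
    exact_mod_cast this
  obtain ⟨μ, hμ1, hμ⟩ := (h0.eventually ((h1.eventually_const_lt h2).and
    (Filter.eventually_gt_atTop c))).exists
  refine ⟨μ, hμ, ?_⟩
  set M := q ^ μ
  have hM0 : (0 : ℝ) < M := by exact_mod_cast (by omega : 0 < M)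
  have : (n * (n - 1 : ℕ) : ℝ) * M ^ d < n * n * (M - c : ℕ) ^ d := by
    rw [Nat.cast_sub hμ.le]
    have e1 : (M - c : ℝ) = (1 - c / M) * M := by field_simp
    rw [e1, mul_pow, ← mul_assoc]
    gcongr
  exact_mod_cast this

theorem zr_siegel {K : Type} [Field K] {d : ℕ} {S : Type} [CommRing S]
    [Algebra (MvPolynomial (Fin d) K) S] {ι κ : Type} [Fintype ι] [Fintype κ]
    (b : Module.Basis ι (MvPolynomial (Fin d) K) S) (e : κ → S) (M B : ℕ)
    (h : Fintype.card ι * M ^ d < Fintype.card κ * B ^ d) :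
    ∃ A : ℕ, 1 ≤ A ∧ ∃ α : (Fin d → Fin A) × (Fin d → Fin B) × κ → K, α ≠ 0 ∧
      ∑ x, (α x • zrMon K (fun t => M * (x.1 t : ℕ) + x.2.1 t)) • e x.2.2 = 0 := by
  classical
  obtain ⟨c, hc⟩ := zrD.exists (Finset.univ : Finset (ι × κ)) (fun x => b.repr (e x.2) x.1)
  obtain ⟨A, hA1, hA⟩ := zr_exists_A _ _ M B (B + c + 1) d h
  refine ⟨A, hA1, ?_⟩
  set D := M * A + (B + c + 1) with hD
  let Sg : ((Fin d → Fin A) × (Fin d → Fin B) × κ → K) → ι → MvPolynomial (Fin d) K :=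
    fun α i => ∑ x, (α x • zrMon K (fun t => M * (x.1 t : ℕ) + x.2.1 t)) * b.repr (e x.2.2) i
  let T : ((Fin d → Fin A) × (Fin d → Fin B) × κ → K) →ₗ[K]
      (ι × (Fin d → Fin D) → K) :=
    { toFun := fun α i => (Sg α i.1).coeff (Finsupp.equivFunOnFinite.symm fun t => (i.2 t : ℕ))
      map_add' := by
        intro α β; funext i
        simp [Sg, add_smul, add_mul, Finset.sum_add_distrib]
      map_smul' := by
        intro a α; funext i
        simp only [Sg, Pi.smul_apply, smul_eq_mul, mul_smul, smul_mul_assoc, RingHom.id_apply]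
        rw [← Finset.smul_sum, MvPolynomial.coeff_smul, smul_eq_mul] }
  have hker : LinearMap.ker T ≠ ⊥ := by
    apply LinearMap.ker_ne_bot_of_finrank_lt
    simp only [Module.finrank_fintype_fun_eq_card, Fintype.card_prod, Fintype.card_pi,
      Fintype.card_fin, Finset.prod_const, Finset.card_univ]
    refine hA.trans_eq ?_
    rw [mul_pow]; ring
  obtain ⟨α, hα, hα0⟩ := Submodule.exists_mem_ne_zero_of_ne_bot hker
  refine ⟨α, hα0, ?_⟩
  apply b.repr.injective
  ext1 i
  have hSg : Sg α i = 0 := by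
    have hdeg : zrD (D - 1) (Sg α i) := by
      apply zrD.sum
      intro x _
      refine zrD.mono (((zrMon_deg _ (M * A + B) ?_).smul (α x)).mul
        (hc (i, x.2.2) (Finset.mem_univ _))) ?_
      · intro t
        have h1 := (x.1 t).2
        have h2 := (x.2.1 t).2
        have := Nat.mul_le_mul_left M h1.le
        omega
      · omega
    ext m
    rw [MvPolynomial.coeff_zero]
    by_cases hm : ∀ t, m t < D
    · have := congrFun (LinearMap.mem_ker.1 hα) (i, fun t => ⟨m t, hm t⟩)
      simp only [T, LinearMap.coe_mk, AddHom.coe_mk, Pi.zero_apply] at this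
      convert this
      ext t; simp
    · push Not at hm
      obtain ⟨t, ht⟩ := hm
      apply MvPolynomial.notMem_support_iff.1
      intro hmem
      have := MvPolynomial.monomial_le_degreeOf t hmem
      have := hdeg t
      omega
  rw [map_sum, Finsupp.finset_sum_apply]
  simp only [map_smul, Finsupp.smul_apply, smul_eq_mul, map_zero, Finsupp.zero_apply]
  exact hSg

end

section

open Polynomial

theorem zr_mon_indep {K F : Type} [Field K] [Field F] [Algebra K F]
    {d n : ℕ} (x : Fin d → F) (y : F)
    (hind : ∀ c : (MvPolynomial (Fin d) K)[X], c.degree < n →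
      c.eval₂ (MvPolynomial.aeval x : MvPolynomial (Fin d) K →ₐ[K] F).toRingHom y = 0 → c = 0)
    (A : ℕ) : LinearIndependent K (fun t : (Fin d → Fin A) × Fin n =>
      (∏ i, x i ^ (t.1 i : ℕ)) * y ^ (t.2 : ℕ)) := by
  rw [Fintype.linearIndependent_iff]
  intro α hα
  set c : (MvPolynomial (Fin d) K)[X] := ∑ s : Fin n,
    C (∑ i : Fin d → Fin A, α (i, s) • zrMon K (fun t => (i t : ℕ))) * X ^ (s : ℕ) with hc
  have h1 : c = 0 := by
    apply hind
    · refine lt_of_le_of_lt (degree_sum_le _ _) ?_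
      rw [Finset.sup_lt_iff]
      · intro s _
        exact lt_of_le_of_lt (degree_C_mul_X_pow_le _ _) (by exact_mod_cast s.2)
      · exact WithBot.bot_lt_coe n
    · rw [hc, eval₂_finset_sum, ← hα, Fintype.sum_prod_type_right]
      refine Finset.sum_congr rfl fun s _ => ?_
      rw [eval₂_mul, eval₂_C, eval₂_X_pow]
      simp only [AlgHom.toRingHom_eq_coe, RingHom.coe_coe, map_sum, map_smul, zrMon_aeval]
      rw [Finset.sum_mul]
      refine Finset.sum_congr rfl fun i _ => ?_
      rw [smul_mul_assoc]
  rintro ⟨i, s⟩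
  have h2 := congrArg (fun p => coeff p (s : ℕ)) h1
  simp only [hc, finset_sum_coeff, coeff_C_mul, coeff_X_pow, coeff_zero, mul_ite, mul_one,
    mul_zero] at h2
  rw [Finset.sum_eq_single s] at h2
  · rw [if_pos rfl] at h2
    refine congrFun (zrMon_inj (fun i : Fin d → Fin A => fun t => (i t : ℕ)) ?_
      (fun i => α (i, s)) h2) i
    intro a b hab
    funext t
    exact Fin.ext (congrFun hab t)
  · intro b _ hb
    rw [if_neg]
    intro h
    exact hb (Fin.ext h.symm)
  · simp

/-- The combined polynomial. -/
noncomputable def zrk {K : Type} [Field K] {d A B n : ℕ}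
    (α : (Fin d → Fin A) × (Fin d → Fin B) × (Fin n × Fin n) → K)
    (r : ℕ → (MvPolynomial (Fin d) K)[X]) (Q : ℕ) : (MvPolynomial (Fin d) K)[X] :=
  ∑ t, C (α t • zrMon K (fun a => (t.1 a : ℕ) + Q * (t.2.1 a : ℕ))) *
    r ((t.2.2.1 : ℕ) + Q * (t.2.2.2 : ℕ))

theorem zrk_eval {K R : Type} [Field K] [CommRing R] [Algebra K R] {d A B n : ℕ}
    (α : (Fin d → Fin A) × (Fin d → Fin B) × (Fin n × Fin n) → K)
    (r : ℕ → (MvPolynomial (Fin d) K)[X]) (Q : ℕ) (f : (MvPolynomial (Fin d) K)[X])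
    (hr : ∀ N, f ∣ X ^ N - r N) (x : Fin d → R) (y : R)
    (hy : f.eval₂ (MvPolynomial.aeval x : MvPolynomial (Fin d) K →ₐ[K] R).toRingHom y = 0) :
    (zrk α r Q).eval₂ (MvPolynomial.aeval x : MvPolynomial (Fin d) K →ₐ[K] R).toRingHom y =
      ∑ t, α t • ((∏ i, x i ^ ((t.1 i : ℕ) + Q * (t.2.1 i : ℕ))) *
        y ^ ((t.2.2.1 : ℕ) + Q * (t.2.2.2 : ℕ))) := by
  rw [zrk, eval₂_finset_sum]
  refine Finset.sum_congr rfl fun t _ => ?_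
  have h1 : ∀ N, (r N).eval₂
      (MvPolynomial.aeval x : MvPolynomial (Fin d) K →ₐ[K] R).toRingHom y = y ^ N := by
    intro N
    have := eval₂_dvd (MvPolynomial.aeval x : MvPolynomial (Fin d) K →ₐ[K] R).toRingHom y (hr N)
    rw [hy, zero_dvd_iff, eval₂_sub, eval₂_X_pow, sub_eq_zero] at this
    exact this.symm
  rw [eval₂_mul, eval₂_C, h1]
  simp only [AlgHom.toRingHom_eq_coe, RingHom.coe_coe, map_smul, zrMon_aeval]
  rw [smul_mul_assoc]

theorem zr_frob {K R : Type} [Field K] [Fintype K] [Field R] [Algebra K R] (m : ℕ)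
    {ι : Type} [Fintype ι] (α : ι → K) (z : ι → R) :
    (∑ t, α t • z t) ^ (Fintype.card K ^ m) = ∑ t, α t • z t ^ (Fintype.card K ^ m) := by
  have h : ∀ a : R, ((FiniteField.frobeniusAlgHom K R) ^ m) a = a ^ (Fintype.card K ^ m) := by
    intro a
    simp [AlgHom.coe_pow, FiniteField.coe_frobeniusAlgHom, pow_iterate]
  rw [← h, map_sum]
  refine Finset.sum_congr rfl fun t _ => ?_
  rw [map_smul, h]

theorem zrk_ne_zero {K F : Type} [Field K] [Fintype K] [Field F] [Algebra K F]
    (hInt : ∀ z : F, (∀ m₀ : ℕ, ∃ m ≥ m₀, ∃ w : F, w ^ (Fintype.card K ^ m) = z) →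
      ∃ a : K, algebraMap K F a = z)
    {d n : ℕ} (x : Fin d → F) (y : F)
    (hind : ∀ c : (MvPolynomial (Fin d) K)[X], c.degree < n →
      c.eval₂ (MvPolynomial.aeval x : MvPolynomial (Fin d) K →ₐ[K] F).toRingHom y = 0 → c = 0)
    {A B : ℕ} (α : (Fin d → Fin A) × (Fin d → Fin B) × (Fin n × Fin n) → K) (hα : α ≠ 0)
    (r : ℕ → (MvPolynomial (Fin d) K)[X]) (f : (MvPolynomial (Fin d) K)[X])
    (hr : ∀ N, f ∣ X ^ N - r N)
    (hy : f.eval₂ (MvPolynomial.aeval x : MvPolynomial (Fin d) K →ₐ[K] F).toRingHom y = 0) :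
    ∃ m₀ : ℕ, ∀ m ≥ m₀, zrk α r (Fintype.card K ^ m) ≠ 0 := by
  let ι := (Fin d → Fin A) × Fin n
  let E := Fintype.equivFin ι
  have hA := zr_mon_indep x y hind A
  have hB := zr_mon_indep x y hind B
  obtain ⟨m₀, hm₀⟩ := zr_indep_frob hInt _ _ (hA.comp E.symm E.symm.injective)
  refine ⟨m₀, fun m hm hk => hα ?_⟩
  have h1 := zrk_eval α r (Fintype.card K ^ m) f hr x y hy
  rw [hk, eval₂_zero] at h1
  let g : ι → F := fun t => ∑ u : (Fin d → Fin B) × Fin n, α (t.1, u.1, (t.2, u.2)) •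
    ((∏ i, x i ^ (u.1 i : ℕ)) * y ^ (u.2 : ℕ))
  have hg : (fun i => g (E.symm i)) = 0 := by
    apply hm₀ m hm
    rw [h1]
    rw [← Equiv.sum_comp E]
    simp only [Function.comp, Equiv.symm_apply_apply, g, zr_frob, Finset.mul_sum]
    rw [← Fintype.sum_prod_type']
    let e2 : ι × ((Fin d → Fin B) × Fin n) ≃
        (Fin d → Fin A) × (Fin d → Fin B) × (Fin n × Fin n) :=
      { toFun := fun t => (t.1.1, t.2.1, (t.1.2, t.2.2))
        invFun := fun t => ((t.1, t.2.2.1), (t.2.1, t.2.2.2))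
        left_inv := fun _ => rfl
        right_inv := fun _ => rfl }
    rw [← Equiv.sum_comp e2]
    refine Finset.sum_congr rfl fun t _ => ?_
    simp only [e2, Equiv.coe_fn_mk, mul_smul_comm]
    congr 1
    rw [mul_pow, ← Finset.prod_pow]
    simp only [pow_add, Finset.prod_mul_distrib, ← pow_mul]
    simp only [mul_comm (Fintype.card K ^ m)]
    ring
  funext ⟨i, j, s, l⟩
  have h2 := congrFun hg (E (i, s))
  simp only [Equiv.symm_apply_apply, Pi.zero_apply] at h2
  exact Fintype.linearIndependent_iff.1 hB (fun u => α (i, u.1, (s, u.2))) h2 (j, l)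

end

section

open Polynomial

/-- The Stepanov step. -/
theorem zr_stepanov {K L : Type} [Field K] [Fintype K] [Field L] [Fintype L] [Algebra K L]
    {d A B μ m : ℕ} (f : (MvPolynomial (Fin d) K)[X]) (hf : f.Monic)
    (u v : (MvPolynomial (Fin d) K)[X]) (w : MvPolynomial (Fin d) K)
    (huv : u * f + v * derivative f = C w)
    {S : Type} [CommRing S] [Algebra (MvPolynomial (Fin d) K) S] (y Y : S)
    (hS : ∀ (Ω : Type) [Field Ω] (φ : MvPolynomial (Fin d) K →+* Ω) (η η' : Ω), η ≠ η' →
        f.eval₂ φ η = 0 → f.eval₂ φ η' = 0 →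
        ∃ ψ : S →+* Ω, ψ.comp (algebraMap _ S) = φ ∧ ψ y = η ∧ ψ Y = η')
    (α : (Fin d → Fin A) × (Fin d → Fin B) × (Fin f.natDegree × Fin f.natDegree) → K)
    (hα : ∑ x, (α x • zrMon K (fun t => Fintype.card K ^ μ * (x.1 t : ℕ) + x.2.1 t)) •
      (y ^ (Fintype.card K ^ μ * (x.2.2.1 : ℕ)) * Y ^ (x.2.2.2 : ℕ)) = 0)
    (r : ℕ → (MvPolynomial (Fin d) K)[X]) (hr : ∀ N, f ∣ X ^ N - r N)
    (hk : (zrk α r (Fintype.card K ^ m)).degree < f.natDegree)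
    (hL : Fintype.card L = Fintype.card K ^ (m + μ))
    (ξ : Fin d → L) (hw : MvPolynomial.aeval ξ w ≠ 0)
    (hno : ¬ ∃ η : L,
      f.eval₂ (MvPolynomial.aeval ξ : MvPolynomial (Fin d) K →ₐ[K] L).toRingHom η = 0) (l : ℕ) :
    MvPolynomial.aeval ξ ((zrk α r (Fintype.card K ^ m)).coeff l) = 0 := by
  classical
  let Ω := AlgebraicClosure L
  let ξ' : Fin d → Ω := fun i => algebraMap L Ω (ξ i)
  let φ : MvPolynomial (Fin d) K →+* Ω :=
    (MvPolynomial.aeval ξ' : MvPolynomial (Fin d) K →ₐ[K] Ω).toRingHom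
  have hφ : ∀ p, φ p = algebraMap L Ω (MvPolynomial.aeval ξ p) := by
    intro p
    exact MvPolynomial.aeval_algebraMap_apply (A := L) Ω ξ p
  have hφ' : φ = (algebraMap L Ω).comp
      (MvPolynomial.aeval ξ : MvPolynomial (Fin d) K →ₐ[K] L).toRingHom := by
    exact RingHom.ext hφ
  set k := zrk α r (Fintype.card K ^ m) with hkdef
  set p : Polynomial Ω := f.map φ with hp
  have hpm : p.Monic := hf.map φ
  have hpd : p.natDegree = f.natDegree := hf.natDegree_map φ
  have hsep : p.Separable := by
    have h1 := congrArg (Polynomial.map φ) huv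
    simp only [Polynomial.map_add, Polynomial.map_mul, Polynomial.map_C, ← derivative_map] at h1
    have hw' : φ w ≠ 0 := by
      rw [hφ]; exact fun h => hw ((algebraMap L Ω).injective (by rw [h, map_zero]))
    refine ⟨C (φ w)⁻¹ * u.map φ, C (φ w)⁻¹ * v.map φ, ?_⟩
    rw [mul_assoc, mul_assoc, ← mul_add, h1, ← C_mul, inv_mul_cancel₀ hw', C_1]
  have hroot : ∀ η : Ω, f.eval₂ φ η = 0 → k.eval₂ φ η = 0 := by
    intro η hη
    have hQ : ∀ a : L, a ^ (Fintype.card K ^ (m + μ)) = a := by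
      intro a; rw [← hL]; exact FiniteField.pow_card a
    -- the conjugate root
    have hη1 : f.eval₂ φ (η ^ (Fintype.card K ^ (m + μ))) = 0 := by
      have h2 : ∀ a : Ω, ((FiniteField.frobeniusAlgHom K Ω) ^ (m+μ)) a =
          a ^ (Fintype.card K ^ (m+μ)) := by
        intro a
        simp [AlgHom.coe_pow, FiniteField.coe_frobeniusAlgHom, pow_iterate]
      have h3 := congrArg ((FiniteField.frobeniusAlgHom K Ω) ^ (m+μ)).toRingHom hη
      rw [hom_eval₂, map_zero] at h3
      have h4 : (((FiniteField.frobeniusAlgHom K Ω) ^ (m+μ)).toRingHom).comp φ = φ := by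
        refine RingHom.ext fun a => ?_
        change ((FiniteField.frobeniusAlgHom K Ω) ^ (m+μ)) (φ a) = φ a
        rw [h2, hφ, ← map_pow, hQ]
      rw [h4] at h3
      rw [← h2]; exact h3
    have hne : η ≠ η ^ (Fintype.card K ^ (m + μ)) := by
      intro h
      have h5 : ∃ a : L, algebraMap L Ω a = η := by
        have hr : η ∈ (Finset.univ.image (algebraMap L Ω)) := by
          have hc1 : (X ^ (Fintype.card L) - X : Polynomial Ω) ≠ 0 :=
            FiniteField.X_pow_card_sub_X_ne_zero Ω Fintype.one_lt_card
          have hsub : Finset.univ.image (algebraMap L Ω) ⊆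
              (X ^ (Fintype.card L) - X : Polynomial Ω).roots.toFinset := by
            intro z hz
            obtain ⟨a, _, rfl⟩ := Finset.mem_image.1 hz
            rw [Multiset.mem_toFinset, mem_roots hc1, IsRoot, eval_sub, eval_pow, eval_X,
              ← map_pow, FiniteField.pow_card, sub_self]
          have := Finset.eq_of_subset_of_card_le hsub (by
            rw [Finset.card_image_of_injective _ (algebraMap L Ω).injective, Finset.card_univ]
            refine (Multiset.toFinset_card_le _).trans ((card_roots' _).trans ?_)
            rw [FiniteField.X_pow_card_sub_X_natDegree_eq Ω Fintype.one_lt_card])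
          rw [this, Multiset.mem_toFinset, mem_roots hc1, IsRoot, eval_sub, eval_pow, eval_X,
            hL, ← h, sub_self]
        obtain ⟨a, _, ha⟩ := Finset.mem_image.1 hr
        exact ⟨a, ha⟩
      obtain ⟨a, rfl⟩ := h5
      apply hno
      refine ⟨a, (algebraMap L Ω).injective ?_⟩
      rw [hom_eval₂, ← hφ', map_zero, hη]
    obtain ⟨ψ, hψ, hψy, hψY⟩ := hS Ω φ η _ hne hη hη1
    have h6 : (k.eval₂ φ η) ^ (Fintype.card K ^ μ) = 0 := by
      rw [hkdef]
      rw [zrk_eval α r (Fintype.card K ^ m) f hr ξ' η hη, zr_frob]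
      have h7 := congrArg ψ hα
      rw [map_zero, map_sum] at h7
      rw [← h7]
      refine Finset.sum_congr rfl fun t _ => ?_
      rw [Algebra.smul_def (A := S), map_mul ψ, ← RingHom.comp_apply, hψ, map_mul ψ, map_pow, map_pow, hψy, hψY]
      change _ = MvPolynomial.aeval ξ' (α t • zrMon K _) * _
      rw [map_smul, zrMon_aeval, smul_mul_assoc]
      congr 1
      rw [mul_pow, ← Finset.prod_pow]
      congr 1
      · refine Finset.prod_congr rfl fun i _ => ?_
        rw [← pow_mul, add_mul, pow_add, pow_add, mul_comm (Fintype.card K ^ μ)]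
        congr 1
        have : Fintype.card K ^ m * (t.2.1 i : ℕ) * Fintype.card K ^ μ =
          Fintype.card K ^ (m+μ) * (t.2.1 i : ℕ) := by ring
        rw [this, pow_mul]
        congr 1
        simp only [ξ']
        rw [← map_pow, hQ]
      · rw [← pow_mul, ← pow_mul, ← pow_add]
        congr 1
        ring
    exact pow_eq_zero_iff (pow_ne_zero _ Fintype.card_ne_zero) |>.1 h6
  have hk0 : k.map φ = 0 := by
    by_contra hne
    have hdvd : p.roots ≤ (k.map φ).roots := by
      rw [Multiset.le_iff_subset (nodup_roots hsep)]
      intro η hη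
      rw [mem_roots hne, IsRoot, eval_map]
      apply hroot
      rw [mem_roots hpm.ne_zero, IsRoot, hp, eval_map] at hη
      exact hη
    have h1 := Multiset.card_le_card hdvd
    have h2 : p.roots.card = p.natDegree :=
      (splits_iff_card_roots.1 (IsAlgClosed.splits p))
    have h3 := card_roots' (k.map φ)
    have h4 : (k.map φ).degree < f.natDegree := lt_of_le_of_lt degree_map_le hk
    rw [degree_eq_natDegree hne] at h4
    have h5 : (k.map φ).natDegree < f.natDegree := by exact_mod_cast h4
    omega
  have h8 := congrArg (fun p => coeff p l) hk0
  simp only [coeff_map, coeff_zero, hφ] at h8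
  exact (algebraMap L Ω).injective (by rw [h8, map_zero])

theorem zr_core {K F : Type} [Field K] [Fintype K] [Field F] [Algebra K F]
    (hInt : ∀ z : F, (∀ m₀ : ℕ, ∃ m ≥ m₀, ∃ w : F, w ^ (Fintype.card K ^ m) = z) →
      ∃ a : K, algebraMap K F a = z)
    {d : ℕ} (x : Fin d → F) (y : F)
    (f : (MvPolynomial (Fin d) K)[X]) (hf : f.Monic) (hn : 1 ≤ f.natDegree)
    (hind : ∀ c : (MvPolynomial (Fin d) K)[X], c.degree < f.natDegree →
      c.eval₂ (MvPolynomial.aeval x : MvPolynomial (Fin d) K →ₐ[K] F).toRingHom y = 0 → c = 0)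
    (hy : f.eval₂ (MvPolynomial.aeval x : MvPolynomial (Fin d) K →ₐ[K] F).toRingHom y = 0)
    (u v : (MvPolynomial (Fin d) K)[X]) (w : MvPolynomial (Fin d) K) (hw0 : w ≠ 0)
    (huv : u * f + v * derivative f = C w) :
    ∃ M : ℕ, 1 ≤ M ∧ ∃ v₀ : ℕ, ∀ v ≥ v₀, ∀ (L : Type) [Field L] [Fintype L] [Algebra K L],
      Fintype.card L = Fintype.card K ^ v →
      (Fintype.card L) ^ d ≤ M ^ d * Nat.card {ξ : Fin d → L // MvPolynomial.aeval ξ w ≠ 0 ∧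
        ∃ η : L, f.eval₂
          (MvPolynomial.aeval ξ : MvPolynomial (Fin d) K →ₐ[K] L).toRingHom η = 0} := by
  classical
  set n := f.natDegree with hndef
  set q := Fintype.card K with hq
  have hq2 : 2 ≤ q := Fintype.one_lt_card
  obtain ⟨c₀, hc₀'⟩ := zrD.exists f.support f.coeff
  have hc₀ : ∀ k, zrD c₀ (f.coeff k) := by
    intro k
    by_cases hk : k ∈ f.support
    · exact hc₀' k hk
    · rw [notMem_support_iff.1 hk]; exact zrD.zero
  obtain ⟨μ, hμ1, hμ⟩ := zr_exists_M q n (c₀ * n + 1) d hq2 hn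
  set M := q ^ μ with hM
  obtain ⟨S, _, _, b, yS, YS, hS⟩ := zr_double f hf
  obtain ⟨A, hA, α, hα0, hα⟩ := zr_siegel b
    (fun t : Fin n × Fin n => yS ^ (M * (t.1 : ℕ)) * YS ^ (t.2 : ℕ)) M (M - (c₀ * n + 1))
    (by simpa using hμ)
  choose r hr1 hr2 hr3 using zr_reduce f hf hn c₀ hc₀
  obtain ⟨m₀, hm₀⟩ := zrk_ne_zero hInt x y hind α hα0 r f hr3 hy
  have hMpos : 1 ≤ M := Nat.one_le_pow _ _ (by omega)
  obtain ⟨m₁, hm₁⟩ : ∃ m₁, ∀ m ≥ m₁, A + c₀ * n + w.totalDegree ≤ q ^ m :=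
    Filter.eventually_atTop.1 ((tendsto_pow_atTop_atTop_of_one_lt hq2).eventually_ge_atTop _)
  refine ⟨M, hMpos, max m₀ m₁ + μ, ?_⟩
  intro v hv L _ _ _ hL
  obtain ⟨m, rfl⟩ : ∃ m, v = m + μ := ⟨v - μ, by omega⟩
  have hk0 := hm₀ m (by omega)
  have hQ := hm₁ m (by omega)
  set Q := q ^ m with hQdef
  set k := zrk α r Q with hkdef
  have hkdeg : k.degree < n := by
    refine lt_of_le_of_lt (degree_sum_le _ _) ?_
    refine (Finset.sup_lt_iff (WithBot.bot_lt_coe n)).2 ?_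
    intro t _
    refine lt_of_le_of_lt (degree_mul_le _ _) ?_
    refine lt_of_le_of_lt (add_le_add degree_C_le le_rfl) ?_
    rw [zero_add]
    exact hr1 _
  obtain ⟨l, hl⟩ : ∃ l, k.coeff l ≠ 0 := by
    by_contra! h
    exact hk0 (Polynomial.ext fun l => by simpa using h l)
  have hkD : zrD (A + Q * (M - (c₀ * n + 1) - 1) + c₀ * (n + Q * (n - 1))) (k.coeff l) := by
    rw [hkdef, zrk, finset_sum_coeff]
    apply zrD.sum
    intro t _
    rw [coeff_C_mul]
    refine zrD.mul ((zrMon_deg _ _ ?_).smul _) ((hr2 _ _).mono ?_)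
    · intro a
      have h1 := (t.1 a).2
      have h2 : (t.2.1 a : ℕ) ≤ M - (c₀ * n + 1) - 1 := by
        have := (t.2.1 a).2
        omega
      have := Nat.mul_le_mul_left Q h2
      omega
    · have h1 := (t.2.2.1).2
      have h2 : (t.2.2.2 : ℕ) ≤ n - 1 := by
        have := (t.2.2.2).2
        omega
      gcongr
  have hgD : zrD (Q * (M - 1)) (w * k.coeff l) := by
    have hwD : zrD w.totalDegree w := fun i => MvPolynomial.degreeOf_le_totalDegree _ _
    refine (hwD.mul hkD).mono ?_
    obtain ⟨e, he⟩ : ∃ e, M = e + 1 + (c₀ * n + 1) := ⟨M - (c₀ * n + 1) - 1, by omega⟩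
    obtain ⟨n', hn'⟩ : ∃ n', n = n' + 1 := ⟨n - 1, by omega⟩
    have e1 : M - (c₀ * n + 1) - 1 = e := by omega
    have e2 : M - 1 = e + 1 + c₀ * n := by omega
    have e3 : n - 1 = n' := by omega
    rw [e1, e2, e3]
    have : c₀ * (Q * n') ≤ c₀ * (Q * n) := by gcongr; omega
    nlinarith
  set g := MvPolynomial.map (algebraMap K L) (w * k.coeff l) with hg
  have hg0 : g ≠ 0 := by
    intro h
    exact mul_ne_zero hw0 hl (MvPolynomial.map_injective _ (algebraMap K L).injective
      (h.trans (map_zero _).symm))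
  have hgD' : ∀ i, g.degreeOf i ≤ Q * (M - 1) := fun i => by
    refine le_trans ?_ (hgD i)
    rw [MvPolynomial.degreeOf_eq_sup, MvPolynomial.degreeOf_eq_sup]
    exact Finset.sup_mono (MvPolynomial.support_map_subset _ _)
  have hSZ := zr_schwartz_zippel (Q * (M - 1)) d g hg0 hgD'
  have hcardL : Fintype.card L = Q * M := by rw [hL, pow_add]
  have hsub : Fintype.card L - Q * (M - 1) = Q := by
    rw [hcardL, ← Nat.mul_sub, Nat.sub_sub_self hMpos, mul_one]
  rw [hsub] at hSZ
  rw [hcardL, mul_pow, mul_comm]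
  refine Nat.mul_le_mul_left _ (hSZ.trans ?_)
  have himp : ∀ ξ : Fin d → L, MvPolynomial.eval ξ g ≠ 0 → MvPolynomial.aeval ξ w ≠ 0 ∧
        ∃ η : L, f.eval₂
          (MvPolynomial.aeval ξ : MvPolynomial (Fin d) K →ₐ[K] L).toRingHom η = 0 := by
    intro ξ hξ
    rw [hg, MvPolynomial.eval_map, ← MvPolynomial.aeval_def, map_mul] at hξ
    refine ⟨left_ne_zero_of_mul hξ, ?_⟩
    by_contra hno
    apply right_ne_zero_of_mul hξ
    exact zr_stepanov (m := m) (μ := μ) f hf u _ w huv yS YS hS α hα r hr3 hkdeg hL ξ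
      (left_ne_zero_of_mul hξ) hno l
  exact Nat.card_le_card_of_injective (fun ξ => ⟨ξ.1, himp ξ.1 ξ.2⟩)
    (fun a b h => by
      simp only [Subtype.mk.injEq] at h
      exact Subtype.ext h)

end

section

open scoped IntermediateField.algebraAdjoinAdjoin in
theorem zr_card_le {K F : Type} [Field K] [Field F] [Algebra K F] {σ : Type} (s : σ → F)
    [Module.Finite (IntermediateField.adjoin K (Set.range s)) F] {N : ℕ} (e : Fin N → F)
    (h : LinearIndependent K (fun t : Fin N × (σ →₀ ℕ) =>
      e t.1 * MvPolynomial.aeval s (MvPolynomial.monomial t.2 (1 : K)))) :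
    N ≤ Module.finrank (IntermediateField.adjoin K (Set.range s)) F := by
  classical
  have hLI : LinearIndependent (Algebra.adjoin K (Set.range s)) e := by
    rw [Fintype.linearIndependent_iff]
    intro g hg
    have hex : ∀ i, ∃ p : MvPolynomial σ K, MvPolynomial.aeval s p = (g i : F) := by
      intro i
      have h3 : ∀ a ∈ Algebra.adjoin K (Set.range s),
          ∃ p : MvPolynomial σ K, MvPolynomial.aeval s p = a := by
        intro a ha
        rw [Algebra.adjoin_range_eq_range_aeval] at ha
        exact ha
      exact h3 _ (g i).2
    choose p hp using hex
    let T : (Fin N → MvPolynomial σ K) →ₗ[K] F :=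
      { toFun := fun p => ∑ i, e i * MvPolynomial.aeval s (p i)
        map_add' := by intro a b; simp [mul_add, Finset.sum_add_distrib]
        map_smul' := by intro a b; simp [Finset.smul_sum] }
    let b := Pi.basis (fun _ : Fin N => MvPolynomial.basisMonomials σ K)
    have hTb : LinearIndependent K (T ∘ b) := by
      have h2 := h.comp (fun t : (_ : Fin N) × (σ →₀ ℕ) => (t.1, t.2)) (by
        rintro ⟨a, b⟩ ⟨c, d⟩ hh
        simp only [Prod.mk.injEq] at hh
        obtain ⟨rfl, rfl⟩ := hh
        rfl)
      convert h2 using 1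
      funext ⟨i, m⟩
      simp only [T, b, Function.comp, LinearMap.coe_mk, AddHom.coe_mk, Pi.basis_apply,
        MvPolynomial.coe_basisMonomials]
      rw [Finset.sum_eq_single i]
      · rw [Pi.single_eq_same]
      · intro j _ hj
        rw [Pi.single_eq_of_ne hj]; simp
      · simp
    have hT : Function.Injective T := by
      have : T = (Finsupp.linearCombination K (T ∘ b)) ∘ₗ (b.repr : _ →ₗ[K] _) := by
        apply b.ext
        intro i
        simp
      rw [this]
      rw [LinearMap.coe_comp]
      exact Function.Injective.comp hTb b.repr.injective
    have hp0 : p = 0 := by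
      apply hT
      rw [map_zero]
      simp only [T, LinearMap.coe_mk, AddHom.coe_mk, hp]
      rw [← hg]
      refine Finset.sum_congr rfl fun i _ => ?_
      rw [mul_comm]; rfl
    intro i
    apply Subtype.ext
    rw [← hp, hp0]
    simp
  have hLI2 := (LinearIndependent.iff_fractionRing (Algebra.adjoin K (Set.range s))
    (IntermediateField.adjoin K (Set.range s))).1 hLI
  simpa using hLI2.fintype_card_le_finrank

theorem zr_finite_over {K F : Type} [Field K] [Field F] [Algebra K F] [Algebra.EssFiniteType K F]
    {σ : Type} (s : σ → F) (hs : IsTranscendenceBasis K s) :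
    Module.Finite (IntermediateField.adjoin K (Set.range s)) F := by
  have h1 := hs.isAlgebraic_field
  have h2 : Algebra.EssFiniteType (IntermediateField.adjoin K (Set.range s)) F := .of_comp K _ _
  exact Algebra.finite_of_essFiniteType_of_isAlgebraic

theorem zr_mon_LI {K F : Type} [Field K] [Field F] [Algebra K F] {σ : Type} (s : σ → F)
    (hs : AlgebraicIndependent K s) : LinearIndependent K (fun m : σ →₀ ℕ =>
      MvPolynomial.aeval s (MvPolynomial.monomial m (1 : K))) := by
  have := (MvPolynomial.basisMonomials σ K).linearIndependent.map'
    (MvPolynomial.aeval s : MvPolynomial σ K →ₐ[K] F).toLinearMap (LinearMap.ker_eq_bot.2 hs)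
  have e : (fun m : σ →₀ ℕ => MvPolynomial.aeval s (MvPolynomial.monomial m (1 : K))) =
      (MvPolynomial.aeval s : MvPolynomial σ K →ₐ[K] F).toLinearMap ∘
        (MvPolynomial.basisMonomials σ K) := by
    funext m; simp
  rw [e]; exact this

theorem zr_algClosure_finite (K F : Type) [Field K] [Field F] [Algebra K F]
    [Algebra.EssFiniteType K F] : Module.Finite K (algebraicClosure K F) := by
  obtain ⟨s, hs⟩ := exists_isTranscendenceBasis K F
  have := zr_finite_over _ hs
  set n := Module.finrank (IntermediateField.adjoin K (Set.range ((↑) : s → F))) F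
  have key : ∀ N : ℕ, ∀ e : Fin N → algebraicClosure K F, LinearIndependent K e → N ≤ n := by
    intro N e he
    apply zr_card_le (K := K) (fun a : s => (a : F)) (fun i => (e i : F))
    have h1 := zr_mon_LI _ (hs.1.algebraicClosure)
    have h2 := linearIndependent_smul he h1
    convert h2 using 1
    funext ⟨i, m⟩
    simp only [MvPolynomial.aeval_monomial, map_one, one_mul]
    rfl
  have hr : Module.rank K (algebraicClosure K F) ≤ n := by
    apply rank_le
    intro t ht
    have := ht.comp (Fintype.equivFin t).symm (Fintype.equivFin t).symm.injective
    simpa using key _ _ this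
  exact Module.rank_lt_aleph0_iff.1 (hr.trans_lt Cardinal.natCast_lt_aleph0)

theorem zr_isAlgebraic_mono {K F : Type} [Field K] [Field F] [Algebra K F]
    (A B : Subalgebra K F) (hle : A ≤ B) (h : Algebra.IsAlgebraic A F) :
    Algebra.IsAlgebraic B F := by
  let := (Subalgebra.inclusion hle).toRingHom.toAlgebra
  have : IsScalarTower A B F := IsScalarTower.of_algebraMap_eq fun _ => rfl
  exact ⟨fun a => (h.isAlgebraic a).extendScalars (Subalgebra.inclusion_injective hle)⟩

theorem zr_theta {K F : Type} [Field K] [Field F] [Algebra K F] {σ : Type} [Fintype σ]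
    [DecidableEq σ] (s : σ → F) (hs : IsTranscendenceBasis K s) (z0 : σ) (w : F) (N : ℕ)
    (hw : w ^ N = s z0) :
    IsTranscendenceBasis K (fun a => if a = z0 then w else s a) := by
  have halg := hs.isAlgebraic
  have hle : Algebra.adjoin K (Set.range s) ≤
      Algebra.adjoin K (Set.range (fun a => if a = z0 then w else s a)) := by
    apply Algebra.adjoin_le
    rintro _ ⟨a, rfl⟩
    by_cases ha : a = z0
    · rw [ha, ← hw]
      have hwm : w ∈ Set.range (fun a => if a = z0 then w else s a) := ⟨z0, by simp⟩
      exact pow_mem (Algebra.subset_adjoin hwm) N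
    · exact Algebra.subset_adjoin ⟨a, by simp [ha]⟩
  have := zr_isAlgebraic_mono _ _ hle halg
  exact Algebra.IsAlgebraic.isTranscendenceBasis_of_le_trdeg_of_finite K _
      hs.cardinalMk_eq_trdeg.le

theorem zr_roots_bound {K F : Type} [Field K] [Field F] [Algebra K F]
    [Algebra.EssFiniteType K F] {σ : Type} [Fintype σ]
    (s : σ → F) (hs : IsTranscendenceBasis K s) (z0 : σ) (w : F) (N : ℕ)
    (hw : w ^ N = s z0) (hN0 : N ≠ 0) :
    N ≤ Module.finrank (IntermediateField.adjoin K (Set.range s)) F := by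
  classical
  have hfin := zr_finite_over _ hs
  have hθ := zr_theta s hs z0 w N hw
  apply zr_card_le (K := K) s (fun i : Fin N => w ^ (i : ℕ))
  have h1 := zr_mon_LI _ hθ.1
  have h2 := h1.comp (fun t : Fin N × (σ →₀ ℕ) => t.2.update z0 (N * t.2 z0 + t.1)) (by
    rintro ⟨i, m⟩ ⟨j, m'⟩ hh
    simp only at hh
    have e0 := DFunLike.congr_fun hh z0
    simp only [Finsupp.coe_update, Function.update_self] at e0
    have hm : m z0 = m' z0 := by
      have := congrArg (· / N) e0
      simpa [Nat.mul_add_div (Nat.pos_of_ne_zero hN0), Nat.div_eq_of_lt] using this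
    have hij : i = j := by
      rw [hm] at e0
      exact Fin.ext (by omega)
    rw [Prod.mk.injEq]
    refine ⟨hij, ?_⟩
    ext a
    by_cases ha : a = z0
    · rw [ha, hm]
    · have := DFunLike.congr_fun hh a
      simpa [Finsupp.coe_update, Function.update_of_ne ha] using this)
  convert h2 using 1
  funext ⟨i, m⟩
  simp only [Function.comp, MvPolynomial.aeval_monomial, map_one, one_mul]
  rw [Finsupp.prod_fintype _ _ (by simp), Finsupp.prod_fintype _ _ (by simp)]
  rw [← Finset.mul_prod_erase Finset.univ _ (Finset.mem_univ z0),
    ← Finset.mul_prod_erase Finset.univ _ (Finset.mem_univ z0), ← mul_assoc]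
  congr 1
  · simp only [Finsupp.coe_update, Function.update_self, if_pos]
    rw [pow_add, pow_mul, hw, mul_comm]
  · refine Finset.prod_congr rfl fun a ha => ?_
    have ha' : a ≠ z0 := Finset.ne_of_mem_erase ha
    simp [Finsupp.coe_update, ha']

theorem zr_isAlg_of_roots {K F : Type} [Field K] [Field F] [Algebra K F]
    [Algebra.EssFiniteType K F] (z : F) (h : ∀ n : ℕ, ∃ N > n, ∃ w : F, w ^ N = z) :
    IsAlgebraic K z := by
  classical
  by_contra hz
  have h0 : AlgebraicIndepOn K id ({z} : Set F) :=
    (algebraicIndependent_unique_type_iff (ι := ({z} : Set F))).2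
      (by simpa [Transcendental] using hz)
  obtain ⟨s, hzs, hs⟩ := exists_isTranscendenceBasis_superset h0
  have hzs' : z ∈ s := hzs rfl
  have hsf : Finite s := by
    rw [← Cardinal.mk_lt_aleph0_iff, hs.cardinalMk_eq_trdeg]
    exact trdeg_lt_aleph0 K F
  have : Fintype s := Fintype.ofFinite s
  obtain ⟨N, hN, w, hw⟩ := h (Module.finrank (IntermediateField.adjoin K
    (Set.range (fun a : s => (a : F)))) F)
  have := zr_roots_bound (K := K) (fun a : s => (a : F)) hs ⟨z, hzs'⟩ w N hw (by omega)
  omega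

end

section

open Polynomial

theorem zr_prim (P k F : Type) [CommRing P] [IsDomain P] [IsIntegrallyClosed P] [Field k] [Field F]
    [Algebra P k] [IsFractionRing P k] [Algebra k F] [Algebra P F] [IsScalarTower P k F]
    [FiniteDimensional k F] [Algebra.IsSeparable k F] :
    ∃ (y : F) (f : Polynomial P), f.Monic ∧ 1 ≤ f.natDegree ∧
      (∀ c : Polynomial P, c.degree < f.natDegree → aeval y c = 0 → c = 0) ∧
      aeval y f = 0 ∧
      (∃ (u v : Polynomial P) (w : P), w ≠ 0 ∧ u * f + v * derivative f = C w) ∧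
      ∀ z : F, ∃ (c : P) (p : Polynomial P), c ≠ 0 ∧ algebraMap P F c * z = aeval y p := by
  have hinj : Function.Injective (algebraMap P k) := IsFractionRing.injective P k
  have hinjF : Function.Injective (algebraMap P F) := by
    rw [IsScalarTower.algebraMap_eq P k F]
    exact (algebraMap k F).injective.comp hinj
  have : FaithfulSMul P F := (faithfulSMul_iff_algebraMap_injective P F).2 hinjF
  have : Module.IsTorsionFree P F := inferInstance
  have nrm : ∀ p : Polynomial k, ∃ (b : P) (p' : Polynomial P), b ≠ 0 ∧
      p'.map (algebraMap P k) = C (algebraMap P k b) * p := by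
    intro p
    obtain ⟨b, hb⟩ := IsLocalization.integerNormalization_spec (nonZeroDivisors P) p
    refine ⟨b, _, nonZeroDivisors.ne_zero hb.1, hb.2.trans ?_⟩
    rw [← smul_eq_C_mul, algebraMap_smul]
  obtain ⟨y0, hy0⟩ := Field.exists_primitive_element k F
  have hal : IsAlgebraic P y0 := by
    have : IsAlgebraic k y0 := Algebra.IsAlgebraic.isAlgebraic y0
    exact (IsFractionRing.isAlgebraic_iff P k F).2 this
  obtain ⟨b0, hb0, hinteg⟩ := hal.exists_integral_multiple
  obtain ⟨y, hydef⟩ : ∃ y, y = b0 • y0 := ⟨_, rfl⟩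
  rw [← hydef] at hinteg
  have hkb : algebraMap P k b0 ≠ 0 := fun h => hb0 (hinj (by rw [h, map_zero]))
  have hgen : Algebra.adjoin k {y} = ⊤ := by
    have h1 : Algebra.adjoin k {y0} = ⊤ := by
      rw [← IntermediateField.adjoin_simple_toSubalgebra_of_isAlgebraic (Algebra.IsAlgebraic.isAlgebraic y0), hy0]
      rfl
    rw [eq_top_iff, ← h1]
    apply Algebra.adjoin_le
    intro z hz
    rw [Set.mem_singleton_iff.1 hz]
    have : y0 = (algebraMap P k b0)⁻¹ • y := by
      rw [hydef, ← algebraMap_smul k b0 y0, smul_smul, inv_mul_cancel₀ hkb, one_smul]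
    rw [this]
    have hyy : y ∈ Algebra.adjoin k {y} := Algebra.subset_adjoin (Set.mem_singleton y)
    exact Subalgebra.smul_mem (Algebra.adjoin k {y}) hyy ((algebraMap P k b0)⁻¹)
  have hmin : minpoly k y = (minpoly P y).map (algebraMap P k) :=
    minpoly.isIntegrallyClosed_eq_field_fractions' k hinteg
  refine ⟨y, minpoly P y, minpoly.monic hinteg, minpoly.natDegree_pos hinteg, ?_, minpoly.aeval _ _, ?_, ?_⟩
  · intro c hc h0
    have h1 : aeval y (c.map (algebraMap P k)) = 0 := by rwa [aeval_map_algebraMap]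
    have h2 := minpoly.dvd k y h1
    have h3 : c.map (algebraMap P k) = 0 := by
      apply Polynomial.eq_zero_of_dvd_of_degree_lt h2
      rw [hmin, degree_map_eq_of_injective hinj, degree_map_eq_of_injective hinj,
        degree_eq_natDegree (minpoly.monic hinteg).ne_zero]
      exact hc
    exact (Polynomial.map_eq_zero_iff hinj).1 h3
  · obtain ⟨a, b, hab⟩ : (minpoly k y).Separable := Algebra.IsSeparable.isSeparable k y
    obtain ⟨ca, a', hca, ha'⟩ := nrm a
    obtain ⟨cb, b', hcb, hb'⟩ := nrm b
    refine ⟨C cb * a', C ca * b', ca * cb, mul_ne_zero hca hcb, ?_⟩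
    apply Polynomial.map_injective _ hinj
    simp only [Polynomial.map_add, Polynomial.map_mul, map_C, ha', hb', map_mul, ← derivative_map, ← hmin]
    linear_combination (C (algebraMap P k ca) * C (algebraMap P k cb)) * hab
  · intro z
    have hz : z ∈ Algebra.adjoin k {y} := by rw [hgen]; trivial
    rw [Algebra.adjoin_singleton_eq_range_aeval] at hz
    obtain ⟨p, rfl⟩ := hz
    obtain ⟨b, p', hb, hp'⟩ := nrm p
    refine ⟨b, p', hb, ?_⟩
    have := congrArg (aeval y) hp'
    rw [aeval_map_algebraMap, map_mul, aeval_C] at this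
    rw [this, ← IsScalarTower.algebraMap_apply]
    rfl

theorem zr_data (K F : Type) [Field K] [PerfectField K] [Field F] [Algebra K F] [Algebra.EssFiniteType K F] :
    ∃ (d : ℕ) (x : Fin d → F), IsTranscendenceBasis K x ∧ ∃ (y : F) (f : Polynomial (MvPolynomial (Fin d) K)),
      f.Monic ∧ 1 ≤ f.natDegree ∧
      (∀ c : Polynomial (MvPolynomial (Fin d) K), c.degree < f.natDegree →
        c.eval₂ (MvPolynomial.aeval x : MvPolynomial (Fin d) K →ₐ[K] F).toRingHom y = 0 → c = 0) ∧
      f.eval₂ (MvPolynomial.aeval x : MvPolynomial (Fin d) K →ₐ[K] F).toRingHom y = 0 ∧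
      (∃ (u v : Polynomial (MvPolynomial (Fin d) K)) (w : MvPolynomial (Fin d) K),
        w ≠ 0 ∧ u * f + v * derivative f = C w) ∧
      ∀ z : F, ∃ (c : MvPolynomial (Fin d) K) (p : Polynomial (MvPolynomial (Fin d) K)), c ≠ 0 ∧
        MvPolynomial.aeval x c * z =
          p.eval₂ (MvPolynomial.aeval x : MvPolynomial (Fin d) K →ₐ[K] F).toRingHom y := by
  obtain ⟨t, ht, hsep⟩ := exists_isTranscendenceBasis_and_isSeparable_of_perfectField K F
  let e : Fin t.card ≃ t := t.equivFin.symm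
  let x : Fin t.card → F := fun i => (e i : F)
  have hx : IsTranscendenceBasis K x := ht.comp_equiv e
  have hr : Set.range x = (t : Set F) := by
    ext z; constructor
    · rintro ⟨i, rfl⟩; exact (e i).2
    · intro hz; exact ⟨e.symm ⟨z, hz⟩, by simp [x]⟩
  have hfin := zr_finite_over x hx
  rw [← hr] at hsep
  let P := MvPolynomial (Fin t.card) K
  let k := IntermediateField.adjoin K (Set.range x)
  have hmem : ∀ p : P, MvPolynomial.aeval x p ∈ k := by
    intro p
    rw [IntermediateField.mem_adjoin_range_iff]
    exact ⟨p, 1, by simp⟩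
  let ψ : P →+* k := (MvPolynomial.aeval x : P →ₐ[K] F).toRingHom.codRestrict k.toSubring hmem
  letI : Algebra P k := ψ.toAlgebra
  letI : Algebra P F := (MvPolynomial.aeval x : P →ₐ[K] F).toRingHom.toAlgebra
  have : IsScalarTower P k F := IsScalarTower.of_algebraMap_eq (fun p => rfl)
  have hpi : Function.Injective (algebraMap P k) := by
    intro a b hab
    apply hx.1
    exact congrArg Subtype.val hab
  have : FaithfulSMul P k := (faithfulSMul_iff_algebraMap_injective P k).2 hpi
  have : IsFractionRing P k := by
    apply IsFractionRing.of_field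
    rintro ⟨z, hz⟩
    obtain ⟨r, s, h⟩ := (IntermediateField.mem_adjoin_range_iff _ _ _).1 hz
    exact ⟨r, s, Subtype.ext h⟩
  have : FiniteDimensional k F := hfin
  have : Algebra.IsSeparable k F := hsep
  obtain ⟨y, f, h1, h2, h3, h4, h5, h6⟩ := zr_prim P k F
  exact ⟨t.card, x, hx, y, f, h1, h2, h3, h4, h5, h6⟩

end

section

open Polynomial

theorem zr_ext_hom {K R A F L : Type} [Field K] [CommRing R] [CommRing A] [Field F] [Field L] [Algebra K A]
    [Algebra K F] [Algebra K L] (k0 : K →+* R) (g : R →+* F) (h : R →+* L)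
    (hg0 : ∀ a, g (k0 a) = algebraMap K F a) (hh0 : ∀ a, h (k0 a) = algebraMap K L a)
    (hker : ∀ r, g r = 0 → h r = 0) (W : R) (hgW : g W ≠ 0) (hhW : h W ≠ 0) (ι : A →ₐ[K] F)
    (hA : ∀ a, ∃ (N : ℕ) (p : R), g W ^ N * ι a = g p) :
    ∃ φ : A →ₐ[K] L, ∀ a (N : ℕ) (p : R), g W ^ N * ι a = g p → h W ^ N * φ a = h p := by
  choose N p hp using hA
  have key : ∀ a (n : ℕ) (r : R), g W ^ n * ι a = g r → h W ^ n * (h (p a) / h W ^ (N a)) = h r := by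
    intro a n r hr
    have h1 : g (W ^ n * p a - W ^ (N a) * r) = 0 := by
      simp only [map_sub, map_mul, map_pow, ← hr, ← hp a]; ring
    have h2 := hker _ h1
    simp only [map_sub, map_mul, map_pow] at h2
    field_simp
    linear_combination h2
  have key0 : ∀ a (n : ℕ) (r : R), g W ^ n * ι a = g r → h (p a) / h W ^ (N a) = h r / h W ^ n := by
    intro a n r hr
    rw [eq_div_iff (pow_ne_zero _ hhW), mul_comm]
    exact key a n r hr
  refine ⟨{ toFun := fun a => h (p a) / h W ^ (N a), map_one' := ?_, map_mul' := ?_, map_zero' := ?_, map_add' := ?_, commutes' := ?_ }, key⟩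
  · rw [key0 1 0 1 (by simp)]; simp
  · intro a b
    rw [key0 (a * b) (N a + N b) (p a * p b) (by rw [map_mul, map_mul, ← hp a, ← hp b]; ring), map_mul, pow_add]
    exact (div_mul_div_comm _ _ _ _).symm
  · rw [key0 0 0 0 (by simp)]; simp
  · intro a b
    show h (p (a + b)) / h W ^ (N (a+b)) = h (p a) / h W ^ (N a) + h (p b) / h W ^ (N b)
    rw [key0 (a + b) (N a + N b) (W ^ (N b) * p a + W ^ (N a) * p b)
      (by simp only [map_add, map_mul, map_pow, ← hp a, ← hp b]; ring)]
    simp only [map_add, map_mul, map_pow]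
    field_simp
    ring
  · intro a
    rw [← hh0, key0 _ 0 (k0 a) (by rw [hg0]; simp)]; simp

theorem zr_finite_hom {K A L : Type} [Field K] [CommRing A] [Algebra K A] [Algebra.FiniteType K A]
    [Field L] [Algebra K L] [Finite L] : Finite (A →ₐ[K] L) := by
  obtain ⟨s, hs⟩ := (Algebra.FiniteType.out : (⊤ : Subalgebra K A).FG)
  apply Finite.of_injective (fun φ : A →ₐ[K] L => fun i : s => φ i)
  intro φ ψ h
  apply AlgHom.ext_of_adjoin_eq_top hs
  intro a ha
  exact congrFun h ⟨a, ha⟩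

/-- Uniform denominators for a finitely generated algebra. -/
theorem zr_denoms {K R A F : Type} [Field K] [CommRing R] [IsDomain R] [CommRing A] [Field F] [Algebra K A]
    [Algebra.FiniteType K A]
    [Algebra K F] {Q : Type} [CommRing Q] [IsDomain Q] (qr : Q →+* R) (k0 : K →+* R) (g : R →+* F)
    (hg0 : ∀ a, g (k0 a) = algebraMap K F a) (ι : A →ₐ[K] F)
    (hz : ∀ z : F, ∃ (c : Q) (p : R), c ≠ 0 ∧ g (qr c) * z = g p) (z0 : F) (w : Q) (hw : w ≠ 0) :
    ∃ c : Q, c ≠ 0 ∧ (∀ a, ∃ (N : ℕ) (p : R), g (qr (c * w)) ^ N * ι a = g p) ∧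
      ∃ (N : ℕ) (p : R), g (qr (c * w)) ^ N * z0 = g p := by
  classical
  obtain ⟨s, hs⟩ := (Algebra.FiniteType.out : (⊤ : Subalgebra K A).FG)
  choose c p hc hp using hz
  let T : Finset F := insert z0 (s.image ι)
  let cc : Q := ∏ z ∈ T, c z
  have hT : ∀ z ∈ T, ∃ (N : ℕ) (p : R), g (qr (cc * w)) ^ N * z = g p := by
    intro z hzT
    obtain ⟨e, he⟩ := Finset.dvd_prod_of_mem c hzT
    refine ⟨1, qr (e * w) * p z, ?_⟩
    have : cc = c z * e := he
    rw [this, map_mul g, ← hp]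
    simp only [map_mul]
    ring
  refine ⟨cc, Finset.prod_ne_zero_iff.2 fun z _ => hc z, ?_, hT z0 (Finset.mem_insert_self _ _)⟩
  intro a
  have ha : a ∈ Algebra.adjoin K (s : Set A) := by rw [hs]; trivial
  induction ha using Algebra.adjoin_induction with
  | mem x hx => exact hT _ (Finset.mem_insert_of_mem (Finset.mem_image_of_mem _ hx))
  | algebraMap r => exact ⟨0, k0 r, by rw [hg0]; simp⟩
  | add x y _ _ hx hy =>
    obtain ⟨N, p, h⟩ := hx
    obtain ⟨N', p', h'⟩ := hy
    refine ⟨N + N', qr (cc * w) ^ N' * p + qr (cc * w) ^ N * p', ?_⟩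
    rw [map_add, map_add, map_mul g, map_mul g, ← h, ← h', map_pow g, map_pow g]
    ring
  | mul x y _ _ hx hy =>
    obtain ⟨N, p, h⟩ := hx
    obtain ⟨N', p', h'⟩ := hy
    refine ⟨N + N', p * p', ?_⟩
    rw [map_mul ι, map_mul g, ← h, ← h']
    ring

theorem zr_lower_geom {K A F : Type} [Field K] [Fintype K] [CommRing A] [Field F] [Algebra K A]
    [Algebra K F] [Algebra.FiniteType K A] [Algebra A F] [IsScalarTower K A F] [IsFractionRing A F]
    [Algebra.EssFiniteType K F]
    (hcl : ∀ z : F, IsAlgebraic K z → ∃ a : K, algebraMap K F a = z) :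
    ∃ (d : ℕ) (x : Fin d → F), IsTranscendenceBasis K x ∧
    ∃ M : ℕ, 1 ≤ M ∧ ∃ v₀, ∀ v ≥ v₀, ∀ (L : Type) [Field L] [Fintype L] [Algebra K L],
    Fintype.card L = Fintype.card K ^ v →
    (Fintype.card L)^d ≤ M^d * Nat.card (A →ₐ[K] L) := by
  obtain ⟨d, x, hx, y, f, hf, hn, hind, hy, ⟨u, v, w, hw0, huv⟩, hz⟩ := zr_data K F
  refine ⟨d, x, hx, ?_⟩
  -- common denominators for x
  obtain ⟨b, hb⟩ := IsLocalization.exist_integer_multiples_of_finite (nonZeroDivisors A) x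
  choose a ha using hb
  have hb0 : algebraMap A F b ≠ 0 := by
    have := (IsLocalization.map_units F b)
    exact this.ne_zero
  let P := MvPolynomial (Fin d) K
  let g : Polynomial P →+* F := eval₂RingHom (MvPolynomial.aeval x : P →ₐ[K] F).toRingHom y
  have hgC : ∀ c : P, g (C c) = MvPolynomial.aeval x c := fun c => eval₂_C _ _
  have hg0 : ∀ a, g ((C.comp MvPolynomial.C) a) = algebraMap K F a := by
    intro a; exact (hgC _).trans (MvPolynomial.aeval_C _ _)
  have hz' : ∀ z : F, ∃ (c : P) (p : Polynomial P), c ≠ 0 ∧ g (C c) * z = g p := by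
    intro z
    obtain ⟨c, p, h1, h2⟩ := hz z
    exact ⟨c, p, h1, by rw [hgC]; exact h2⟩
  obtain ⟨c, hc, hA, ⟨N0, p0, hbi⟩⟩ := zr_denoms (C : P →+* Polynomial P) (C.comp MvPolynomial.C) g hg0
    (IsScalarTower.toAlgHom K A F) hz' (algebraMap A F b)⁻¹ w hw0
  have hW0 : c * w ≠ 0 := mul_ne_zero hc hw0
  have hInt : ∀ z : F, (∀ m₀, ∃ m ≥ m₀, ∃ w : F, w ^ (Fintype.card K ^ m) = z) → ∃ a : K, algebraMap K F a = z := by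
    intro z h
    apply hcl
    apply zr_isAlg_of_roots z
    intro n
    obtain ⟨m, hm, w, hw⟩ := h n
    exact ⟨_, lt_of_le_of_lt hm (Nat.lt_pow_self Fintype.one_lt_card), w, hw⟩
  obtain ⟨M, hM, v₀, hcore⟩ := zr_core hInt x y f hf hn hind hy (C c * u) (C c * v) (c * w) hW0
    (by rw [C_mul, ← huv]; ring)
  refine ⟨M, hM, v₀, ?_⟩
  intro v hv L _ _ _ hL
  refine (hcore v hv L hL).trans (Nat.mul_le_mul_left _ ?_)
  have : Finite (A →ₐ[K] L) := zr_finite_hom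
  have hgW : g (C (c * w)) ≠ 0 := by
    have : g (C (c * w)) = MvPolynomial.aeval x (c * w) := hgC _
    rw [this]
    intro h
    exact hW0 (hx.1 (by rw [h, map_zero]))
  have hpt : ∀ ξ : {ξ : Fin d → L // MvPolynomial.aeval ξ (c * w) ≠ 0 ∧
      ∃ η : L, f.eval₂ (MvPolynomial.aeval ξ : MvPolynomial (Fin d) K →ₐ[K] L).toRingHom η = 0},
      ∃ φ : A →ₐ[K] L, φ b ≠ 0 ∧ ∀ i, φ (a i) = φ b * ξ.1 i := by
    rintro ⟨ξ, hξ, η, hη⟩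
    let h : Polynomial P →+* L := eval₂RingHom (MvPolynomial.aeval ξ : P →ₐ[K] L).toRingHom η
    have hhC : ∀ c : P, h (C c) = MvPolynomial.aeval ξ c := fun c => eval₂_C _ _
    have hh0 : ∀ a, h ((C.comp MvPolynomial.C) a) = algebraMap K L a := by
      intro a; exact (hhC _).trans (MvPolynomial.aeval_C _ _)
    have hker : ∀ r, g r = 0 → h r = 0 := by
      intro r hr
      have h1 := modByMonic_add_div r f
      have h2 : g f = 0 := hy
      have h3 : g (r %ₘ f) = 0 := by
        rw [← h1, map_add, map_mul, h2] at hr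
        simpa using hr
      have h4 : r %ₘ f = 0 := by
        apply hind _ _ h3
        rw [← degree_eq_natDegree hf.ne_zero]
        exact degree_modByMonic_lt r hf
      have h5 : h f = 0 := hη
      rw [← h1, h4, map_add, map_mul, h5]; simp
    have hhW : h (C (c * w)) ≠ 0 := by
      have : h (C (c * w)) = MvPolynomial.aeval ξ (c * w) := hhC _
      rw [this]; exact hξ
    obtain ⟨φ, hφ⟩ := zr_ext_hom (C.comp MvPolynomial.C) g h hg0 hh0 hker (C (c * w)) hgW hhW
      (IsScalarTower.toAlgHom K A F) hA
    refine ⟨φ, ?_, ?_⟩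
    · obtain ⟨N, p, hp⟩ := hA b
      have h1 := hφ _ _ _ hp
      have h2 : g (p * p0) = g (C (c * w) ^ (N + N0)) := by
        rw [map_mul, ← hp, ← hbi, map_pow]
        have : (IsScalarTower.toAlgHom K A F) (b : A) = algebraMap A F b := rfl
        rw [this]
        field_simp
        try ring
      have h3 : h (p * p0 - C (c * w) ^ (N + N0)) = 0 := hker _ (by rw [map_sub, h2, sub_self])
      intro hb
      rw [hb, mul_zero] at h1
      rw [map_sub, map_mul, ← h1, map_pow, zero_mul, zero_sub, neg_eq_zero] at h3
      exact pow_ne_zero _ hhW h3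
    · intro i
      obtain ⟨N, p, hp⟩ := hA b
      have h1 := hφ _ _ _ hp
      have h2 : g (C (c * w)) ^ N * (IsScalarTower.toAlgHom K A F) (a i) = g (p * C (MvPolynomial.X i)) := by
        have e1 : (IsScalarTower.toAlgHom K A F) (a i) = algebraMap A F (a i) := rfl
        have e2 : (IsScalarTower.toAlgHom K A F) (b : A) = algebraMap A F b := rfl
        have e3 : g (C (MvPolynomial.X i)) = x i := by rw [hgC, MvPolynomial.aeval_X]
        have e4 : algebraMap A F (a i) = algebraMap A F b * x i := by
          rw [ha i, Algebra.smul_def]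
        rw [map_mul g p, ← hp, e1, e2, e3, e4]; ring
      have h3 := hφ _ _ _ h2
      have e3 : h (C (MvPolynomial.X i)) = ξ i := by rw [hhC, MvPolynomial.aeval_X]
      rw [map_mul h p, ← h1, e3] at h3
      have := pow_ne_zero N hhW
      apply mul_left_cancel₀ this
      rw [h3]; ring
  choose Φ hΦ1 hΦ2 using hpt
  apply Nat.card_le_card_of_injective Φ
  intro ξ ξ' h
  apply Subtype.ext
  funext i
  have h1 := hΦ2 ξ i
  have h2 := hΦ2 ξ' i
  rw [← h] at h2
  exact mul_left_cancel₀ (hΦ1 ξ) (h1.symm.trans h2)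

end

section

theorem zr_ext_exists (K : Type) [Field K] [Finite K] (n : ℕ) (hn : 1 ≤ n) :
    ∃ (L : Type) (_ : Field L) (_ : Fintype L) (_ : Algebra K L), Module.finrank K L = n ∧
      Fintype.card L = Nat.card K ^ n := by
  obtain ⟨p, hp⟩ := CharP.exists K
  have hpp : Fact p.Prime := ⟨CharP.char_is_prime K p⟩
  have : NeZero n := ⟨by omega⟩
  let L := FiniteField.Extension K p n
  have : Finite L := Module.finite_of_finite K
  refine ⟨L, inferInstance, Fintype.ofFinite L, inferInstance, FiniteField.finrank_extension K p n, ?_⟩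
  rw [Fintype.card_eq_nat_card]
  exact FiniteField.natCard_extension K p n

theorem zr_lower_dom {K A : Type} [Field K] [Fintype K] [CommRing A] [IsDomain A] [Algebra K A]
    [Algebra.FiniteType K A] {d : ℕ} (a : Fin d → A) (ha : AlgebraicIndependent K a) :
    ∃ m : ℕ, 1 ≤ m ∧ ∃ M : ℕ, 1 ≤ M ∧ ∃ v₀, ∀ v ≥ v₀, ∃ (L : Type) (_ : Field L) (_ : Fintype L)
      (_ : Algebra K L), Module.finrank K L = m * v ∧
      (Fintype.card L) ^ d ≤ M * Nat.card (A →ₐ[K] L) := by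
  let F := FractionRing A
  have hess : Algebra.EssFiniteType K F :=
    have : Algebra.EssFiniteType A F := Algebra.EssFiniteType.of_isLocalization F (nonZeroDivisors A)
    Algebra.EssFiniteType.comp K A F
  let K' := algebraicClosure K F
  have hK' : Module.Finite K K' := zr_algClosure_finite K F
  have : Finite K' := Module.finite_of_finite K
  let _ : Fintype K' := Fintype.ofFinite K'
  have : Algebra.EssFiniteType K' F := Algebra.EssFiniteType.of_comp K K' F
  obtain ⟨s, hs⟩ := (Algebra.FiniteType.out : (⊤ : Subalgebra K A).FG)
  let A' : Subalgebra K' F := Algebra.adjoin K' (algebraMap A F '' s)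
  have hft : Algebra.FiniteType K' A' :=
    (Subalgebra.fg_iff_finiteType A').1 (by
      classical
      exact ⟨s.image (algebraMap A F), by rw [Finset.coe_image]⟩)
  have hmem : ∀ z : A, algebraMap A F z ∈ A' := by
    intro z
    have hz : z ∈ Algebra.adjoin K (s : Set A) := by rw [hs]; trivial
    induction hz using Algebra.adjoin_induction with
    | mem x hx => exact Algebra.subset_adjoin ⟨x, hx, rfl⟩
    | algebraMap r =>
      rw [← IsScalarTower.algebraMap_apply K A F, IsScalarTower.algebraMap_apply K K' F]
      exact A'.algebraMap_mem _
    | add x y _ _ hx hy => rw [map_add]; exact add_mem hx hy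
    | mul x y _ _ hx hy => rw [map_mul]; exact mul_mem hx hy
  have hfr : IsFractionRing A' F := by
    apply IsFractionRing.of_field
    intro z
    obtain ⟨x, y, hy, rfl⟩ := IsFractionRing.div_surjective (A := A) z
    exact ⟨⟨_, hmem x⟩, ⟨_, hmem y⟩, rfl⟩
  have hcl : ∀ z : F, IsAlgebraic K' z → ∃ a : K', algebraMap K' F a = z := by
    intro z hz
    have : Algebra.IsAlgebraic K K' := inferInstance
    have hz' : IsAlgebraic K z := hz.restrictScalars K
    exact ⟨⟨z, mem_algebraicClosure_iff.2 hz'⟩, rfl⟩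
  obtain ⟨d', x, hx, M, hM, v₀, hlow⟩ := zr_lower_geom (K := K') (A := A') (F := F) hcl
  have hdd : d ≤ d' := by
    have h1 : AlgebraicIndependent K (algebraMap A F ∘ a) :=
      ha.map' (f := IsScalarTower.toAlgHom K A F) (IsFractionRing.injective A F)
    have h2 : AlgebraicIndependent K' (algebraMap A F ∘ a) := h1.algebraicClosure
    have h3 := h2.cardinalMk_le_trdeg
    rw [← hx.cardinalMk_eq_trdeg] at h3
    simpa using h3
  refine ⟨Module.finrank K K', Module.finrank_pos, M ^ d', Nat.one_le_pow _ _ hM, v₀ + 1, ?_⟩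
  intro v hv
  obtain ⟨L, _, _, _, hfr, hcard⟩ := zr_ext_exists K' v (by omega)
  let _ : Algebra K L := ((algebraMap K' L).comp (algebraMap K K')).toAlgebra
  have : IsScalarTower K K' L := IsScalarTower.of_algebraMap_eq (fun _ => rfl)
  refine ⟨L, inferInstance, inferInstance, inferInstance, ?_, ?_⟩
  · rw [← Module.finrank_mul_finrank K K' L, hfr]
  · have h1 := hlow v (by omega) L (by rw [hcard, Nat.card_eq_fintype_card])
    calc Fintype.card L ^ d ≤ Fintype.card L ^ d' := Nat.pow_le_pow_right Fintype.card_pos hdd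
      _ ≤ _ := h1
      _ ≤ _ := Nat.mul_le_mul_left _ ?_
    have : Finite (A →ₐ[K] L) := zr_finite_hom
    let j : A →+* A' := (algebraMap A F).codRestrict A' hmem
    have hjK : ∀ r : K, j (algebraMap K A r) = algebraMap K' A' (algebraMap K K' r) := by
      intro r
      apply Subtype.ext
      show algebraMap A F (algebraMap K A r) = algebraMap K' F (algebraMap K K' r)
      rw [← IsScalarTower.algebraMap_apply K A F, ← IsScalarTower.algebraMap_apply K K' F]
    let Ψ : (A' →ₐ[K'] L) → (A →ₐ[K] L) := fun φ =>
      { (φ : A' →+* L).comp j with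
        commutes' := fun r => by
          show φ (j (algebraMap K A r)) = _
          rw [hjK, φ.commutes]; rfl }
    apply Nat.card_le_card_of_injective Ψ
    intro φ ψ h
    apply AlgHom.adjoin_ext
    rintro _ ⟨z, hz, rfl⟩
    exact DFunLike.congr_fun h z

theorem zr_lower_alg {K A : Type} [Field K] [Fintype K] [CommRing A] [Algebra K A]
    [Algebra.FiniteType K A] (d : ℕ) (hd : (d : WithBot ℕ∞) ≤ ringKrullDim A) :
    ∃ m : ℕ, 1 ≤ m ∧ ∃ M : ℕ, 1 ≤ M ∧ ∃ v₀, ∀ v ≥ v₀, ∃ (L : Type) (_ : Field L) (_ : Fintype L)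
      (_ : Algebra K L), Module.finrank K L = m * v ∧
      (Fintype.card L) ^ d ≤ M * Nat.card (A →ₐ[K] L) := by
  have : Nontrivial A := by
    by_contra h
    rw [not_nontrivial_iff_subsingleton] at h
    rw [ringKrullDim_eq_bot_of_subsingleton] at hd
    simp at hd
  obtain ⟨s, g, hg, hinteg⟩ := exists_integral_inj_algHom_of_fg K A
  let _ : Algebra (MvPolynomial (Fin s) K) A := g.toRingHom.toAlgebra
  have hi : Algebra.IsIntegral (MvPolynomial (Fin s) K) A := ⟨hinteg⟩
  have hds : d ≤ s := by
    have h1 : ringKrullDim A ≤ ringKrullDim (MvPolynomial (Fin s) K) := by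
      apply Order.krullDim_le_of_strictMono (PrimeSpectrum.comap (algebraMap (MvPolynomial (Fin s) K) A))
      intro p q hpq
      exact Ideal.IsIntegral.comap_lt_comap hpq
    rw [MvPolynomial.ringKrullDim_of_isNoetherianRing, ringKrullDim_eq_zero_of_field, zero_add] at h1
    have h2 := hd.trans h1
    simpa using h2
  obtain ⟨Q, hQ1, hQ⟩ : ∃ Q : Ideal A, Q.IsPrime ∧ Q.comap (algebraMap (MvPolynomial (Fin s) K) A) = ⊥ := by
    obtain ⟨Q, _, h1, h2⟩ := Ideal.exists_ideal_over_prime_of_isIntegral (S := A) (⊥ : Ideal (MvPolynomial (Fin s) K)) (⊥ : Ideal A)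
      (by rw [← RingHom.ker_eq_comap_bot]; exact ((RingHom.injective_iff_ker_eq_bot _).1 hg).le)
    exact ⟨Q, h1, h2⟩
  let a : Fin s → A ⧸ Q := fun i => Ideal.Quotient.mk Q (g (MvPolynomial.X i))
  have ha : AlgebraicIndependent K a := by
    rw [algebraicIndependent_iff_injective_aeval]
    have : (MvPolynomial.aeval a : MvPolynomial (Fin s) K →ₐ[K] A ⧸ Q) = (Ideal.Quotient.mkₐ K Q).comp g := by
      apply MvPolynomial.algHom_ext
      intro i
      simp [a]
    rw [this]
    rw [injective_iff_map_eq_zero]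
    intro p hp
    have : g p ∈ Q := Ideal.Quotient.eq_zero_iff_mem.1 hp
    have h2 : p ∈ Q.comap (algebraMap (MvPolynomial (Fin s) K) A) := this
    rw [hQ] at h2
    exact h2
  obtain ⟨m, hm, M, hM, v₀, h⟩ := zr_lower_dom a ha
  refine ⟨m, hm, M, hM, v₀, fun v hv => ?_⟩
  obtain ⟨L, _, _, _, h1, h2⟩ := h v hv
  refine ⟨L, inferInstance, inferInstance, inferInstance, h1, ?_⟩
  refine (Nat.pow_le_pow_right Fintype.card_pos hds).trans (h2.trans (Nat.mul_le_mul_left _ ?_))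
  have : Finite (A →ₐ[K] L) := zr_finite_hom
  apply Nat.card_le_card_of_injective (fun φ : (A ⧸ Q) →ₐ[K] L => φ.comp (Ideal.Quotient.mkₐ K Q))
  intro φ ψ h
  exact Ideal.Quotient.algHom_ext _ h

end

section

open Polynomial

theorem zr_upper_alg {K A : Type} [Field K] [CommRing A] [Algebra K A]
    [Algebra.FiniteType K A] (d : ℕ) (hd : ringKrullDim A ≤ (d : WithBot ℕ∞)) :
    ∃ B : ℕ, ∀ (L : Type) [Field L] [Fintype L] [Algebra K L],
      Nat.card (A →ₐ[K] L) ≤ B * (Fintype.card L) ^ d := by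
  classical
  rcases subsingleton_or_nontrivial A with hA | hA
  · refine ⟨0, fun L _ _ _ => ?_⟩
    have : IsEmpty (A →ₐ[K] L) := ⟨fun φ => by
      have h : (1 : A) = 0 := Subsingleton.elim _ _
      have := congrArg φ h
      simp at this⟩
    simp
  obtain ⟨s, g, hg, hinteg⟩ := exists_integral_inj_algHom_of_fg K A
  let P := MvPolynomial (Fin s) K
  let _ : Algebra P A := g.toRingHom.toAlgebra
  have hi : Algebra.IsIntegral P A := ⟨hinteg⟩
  have hsd : s ≤ d := by
    have h1 : ringKrullDim P ≤ ringKrullDim A := by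
      apply iSup_le
      intro l
      obtain ⟨Q, _, h1, h2⟩ := Ideal.exists_ideal_over_prime_of_isIntegral (S := A) l.head.asIdeal (⊥ : Ideal A)
        (by rw [← RingHom.ker_eq_comap_bot, (RingHom.injective_iff_ker_eq_bot (algebraMap P A)).1 hg]; exact bot_le)
      have : Q.LiesOver l.head.asIdeal := ⟨h2.symm⟩
      obtain ⟨L, hL, _⟩ := Ideal.exists_ltSeries_of_hasGoingUp l Q
      rw [← hL]
      exact le_iSup (fun l : LTSeries (PrimeSpectrum A) => (l.length : WithBot ℕ∞)) L
    rw [MvPolynomial.ringKrullDim_of_isNoetherianRing, ringKrullDim_eq_zero_of_field, zero_add] at h1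
    have h2 := h1.trans hd
    simpa using h2
  obtain ⟨S, hS⟩ := (Algebra.FiniteType.out : (⊤ : Subalgebra K A).FG)
  have hinteg2 : ∀ a : A, ∃ p : Polynomial P, p.Monic ∧ p.eval₂ g.toRingHom a = 0 := fun a => hinteg a
  choose p hpm hp using hinteg2
  refine ⟨∏ a : S, (p a).natDegree, fun L _ _ _ => ?_⟩
  have : Finite (A →ₐ[K] L) := zr_finite_hom
  let _ : Fintype (A →ₐ[K] L) := Fintype.ofFinite _
  let r : (A →ₐ[K] L) → (Fin s → L) := fun φ i => φ (g (MvPolynomial.X i))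
  have hr : ∀ φ : A →ₐ[K] L, φ.comp g = MvPolynomial.aeval (r φ) := by
    intro φ
    apply MvPolynomial.algHom_ext
    intro i
    simp [r]
  rw [Nat.card_eq_fintype_card]
  have hcard := Finset.card_le_mul_card_image_of_maps_to (f := r) (s := Finset.univ) (t := Finset.univ)
    (fun a _ => Finset.mem_univ _) (∏ a : S, (p a).natDegree) ?_
  · refine hcard.trans (Nat.mul_le_mul_left _ ?_)
    rw [Finset.card_univ, Fintype.card_fun, Fintype.card_fin]
    exact Nat.pow_le_pow_right Fintype.card_pos hsd
  · intro ξ _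
    let e : P →+* L := (MvPolynomial.aeval ξ : P →ₐ[K] L).toRingHom
    let R : S → Finset L := fun a => ((p a).map e).roots.toFinset
    have hRc : ∀ a, (R a).card ≤ (p a).natDegree := by
      intro a
      refine (Multiset.toFinset_card_le _).trans ((card_roots' _).trans ?_)
      exact natDegree_map_le
    calc _ ≤ (Fintype.piFinset R).card := ?_
      _ = ∏ a, (R a).card := Fintype.card_piFinset _
      _ ≤ _ := Finset.prod_le_prod' fun a _ => hRc a
    apply Finset.card_le_card_of_injOn (fun φ (a : S) => φ a)
    · intro φ hφ
      have hφ' : r φ = ξ := by simpa using hφ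
      show (fun a : S => φ a) ∈ (Fintype.piFinset R : Set _)
      rw [Finset.mem_coe, Fintype.mem_piFinset]
      intro a
      show φ a ∈ ((p a).map e).roots.toFinset
      rw [Multiset.mem_toFinset, mem_roots ((hpm a).map e).ne_zero, IsRoot, eval_map]
      have h1 := congrArg φ (hp a)
      have h2 : (φ : A →+* L).comp g.toRingHom = e := by
        have := congrArg AlgHom.toRingHom (hr φ)
        rw [hφ'] at this
        exact this
      have h3 : φ ((p a).eval₂ g.toRingHom a) = (p a).eval₂ ((φ : A →+* L).comp g.toRingHom) (φ a) :=
        hom_eval₂ (p a) g.toRingHom (φ : A →+* L) a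
      rw [h2] at h3
      rw [← h3, h1, map_zero]
    · intro φ _ ψ _ h
      apply AlgHom.ext_of_adjoin_eq_top hS
      intro a ha
      exact congrFun h ⟨a, ha⟩

end

section

open AlgebraicGeometry CategoryTheory

theorem zr_chart (X : Scheme.{0}) (x : X) : ∃ (R : CommRingCat.{0}) (j : Spec R ⟶ X),
    IsOpenImmersion j ∧ x ∈ Set.range j := by
  obtain ⟨R, j, h, hx, _⟩ := X.exists_affine_mem_range_and_range_subset (x := x) (U := ⊤) trivial
  exact ⟨R, j, h, hx⟩

theorem zr_chart_dim_le {X : Scheme.{0}} {R : CommRingCat.{0}} (j : Spec R ⟶ X) [IsOpenImmersion j] :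
    ringKrullDim R ≤ topologicalKrullDim X := by
  rw [← PrimeSpectrum.topologicalKrullDim_eq_ringKrullDim R]
  change topologicalKrullDim (Spec R) ≤ _
  exact j.isOpenEmbedding.isInducing.topologicalKrullDim_le

theorem zr_chart_dim_ge (X : Scheme.{0}) (d : ℕ) (hd : (d : WithBot ℕ∞) ≤ topologicalKrullDim X) :
    ∃ (R : CommRingCat.{0}) (j : Spec R ⟶ X), IsOpenImmersion j ∧ (d : WithBot ℕ∞) ≤ ringKrullDim R := by
  obtain ⟨l, hl⟩ := Order.le_krullDim_iff.1 hd
  obtain ⟨x, hx⟩ := l.head.isIrreducible'.nonempty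
  obtain ⟨R, j, hj, y, hy⟩ := zr_chart X x
  refine ⟨R, j, hj, ?_⟩
  rw [← PrimeSpectrum.topologicalKrullDim_eq_ringKrullDim R]
  change _ ≤ topologicalKrullDim (Spec R)
  refine Order.le_krullDim_iff.2 ?_
  let o := TopologicalSpace.IrreducibleCloseds.orderIsoOfIsOpenEmbedding j j.isOpenEmbedding
  have hmem : ∀ i, (j ⁻¹' (l i : Set X)).Nonempty := by
    intro i
    refine ⟨y, ?_⟩
    show j y ∈ (l i : Set X)
    rw [hy]
    exact (LTSeries.head_le l i : l.head ≤ l i) hx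
  refine ⟨⟨l.length, fun i => o.symm ⟨l i, hmem i⟩, fun i => ?_⟩, hl⟩
  exact o.symm.strictMono (l.step i)

/-- Data of a chart as an algebra. -/
theorem zr_chart_alg {K : Type} [Field K] {X : Scheme.{0}} (f : X ⟶ Spec (CommRingCat.of K))
    [LocallyOfFiniteType f] {R : CommRingCat.{0}} (j : Spec R ⟶ X) [IsOpenImmersion j] :
    ∃ (φ : K →+* R), φ.FiniteType ∧ j ≫ f = Spec.map (CommRingCat.ofHom φ) := by
  refine ⟨(Spec.preimage (j ≫ f)).hom, ?_, ?_⟩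
  · have h : LocallyOfFiniteType (Spec.map (Spec.preimage (j ≫ f))) := by
      rw [Spec.map_preimage]; infer_instance
    exact (HasRingHomProperty.Spec_iff (P := @LocallyOfFiniteType)).1 h
  · rw [CommRingCat.ofHom_hom, Spec.map_preimage]

theorem zr_alg_to_pts {K : Type} [Field K] {X : Scheme.{0}} (f : X ⟶ Spec (CommRingCat.of K))
    {R : CommRingCat.{0}} (j : Spec R ⟶ X) [IsOpenImmersion j] [Algebra K R]
    (hφ : j ≫ f = Spec.map (CommRingCat.ofHom (algebraMap K R))) (L : Type) [Field L] [Algebra K L] :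
    ∃ Ψ : (R →ₐ[K] L) → { g : Spec (CommRingCat.of L) ⟶ X //
        g ≫ f = Spec.map (CommRingCat.ofHom (algebraMap K L)) }, Function.Injective Ψ ∧
      ∀ g, (∃ h, h ≫ j = g.1) → g ∈ Set.range Ψ := by
  have hcomp : ∀ α : R →ₐ[K] L, (Spec.map (CommRingCat.ofHom (α : R →+* L)) ≫ j) ≫ f =
      Spec.map (CommRingCat.ofHom (algebraMap K L)) := by
    intro α
    rw [Category.assoc, hφ, ← Spec.map_comp, ← CommRingCat.ofHom_comp]
    congr 2
    exact α.comp_algebraMap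
  refine ⟨fun α => ⟨Spec.map (CommRingCat.ofHom (α : R →+* L)) ≫ j, hcomp α⟩, ?_, ?_⟩
  · intro α β h
    have h1 := congrArg Subtype.val h
    have h2 := (cancel_mono j).1 h1
    have h3 := Spec.map_injective h2
    have h4 := congrArg CommRingCat.Hom.hom h3
    apply AlgHom.ext
    intro r
    exact DFunLike.congr_fun h4 r
  · rintro ⟨g, hg⟩ ⟨h, hh⟩
    have hh' : h ≫ j = g := hh
    have hcm : (Spec.preimage h).hom.comp (algebraMap K R) = algebraMap K L := by
      have h1 : Spec.map (CommRingCat.ofHom (algebraMap K R) ≫ Spec.preimage h) =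
          Spec.map (CommRingCat.ofHom (algebraMap K L)) := by
        rw [Spec.map_comp, Spec.map_preimage, ← hφ, ← Category.assoc, hh', hg]
      have h2 := Spec.map_injective h1
      have h3 := congrArg CommRingCat.Hom.hom h2
      exact h3
    let α : R →ₐ[K] L := { (Spec.preimage h).hom with commutes' := fun r => DFunLike.congr_fun hcm r }
    refine ⟨α, ?_⟩
    apply Subtype.ext
    show Spec.map (CommRingCat.ofHom (α : R →+* L)) ≫ j = g
    rw [← hh']
    congr 1
    exact Spec.map_preimage h

theorem zr_scheme_lower {K : Type} [Field K] [Fintype K] {X : Scheme.{0}} (f : X ⟶ Spec (CommRingCat.of K))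
    [LocallyOfFiniteType f] (d : ℕ) (hd : (d : WithBot ℕ∞) ≤ topologicalKrullDim X) :
    ∃ m : ℕ, 1 ≤ m ∧ ∃ M : ℕ, 1 ≤ M ∧ ∃ v₀, ∀ v ≥ v₀, ∃ (L : Type) (_ : Field L) (_ : Fintype L)
      (_ : Algebra K L), Module.finrank K L = m * v ∧
      (Finite { g : Spec (CommRingCat.of L) ⟶ X //
        g ≫ f = Spec.map (CommRingCat.ofHom (algebraMap K L)) } → 
      (Fintype.card L) ^ d ≤ M * Nat.card { g : Spec (CommRingCat.of L) ⟶ X //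
        g ≫ f = Spec.map (CommRingCat.ofHom (algebraMap K L)) }) := by
  obtain ⟨R, j, hj, hR⟩ := zr_chart_dim_ge X d hd
  obtain ⟨φ, hft, hφ⟩ := zr_chart_alg f j
  let _ : Algebra K R := φ.toAlgebra
  have : Algebra.FiniteType K R := hft
  obtain ⟨m, hm, M, hM, v₀, h⟩ := zr_lower_alg (K := K) (A := R) d hR
  refine ⟨m, hm, M, hM, v₀, fun v hv => ?_⟩
  obtain ⟨L, i1, i2, i3, h1, h2⟩ := h v hv
  refine ⟨L, i1, i2, i3, h1, fun hfin => h2.trans (Nat.mul_le_mul_left _ ?_)⟩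
  obtain ⟨Ψ, hΨ, _⟩ := zr_alg_to_pts f j hφ L
  exact Nat.card_le_card_of_injective Ψ hΨ

theorem zr_scheme_upper {K : Type} [Field K] {X : Scheme.{0}} (f : X ⟶ Spec (CommRingCat.of K))
    [LocallyOfFiniteType f] [QuasiCompact f] (d : ℕ) (hd : topologicalKrullDim X ≤ (d : WithBot ℕ∞)) :
    ∃ B : ℕ, ∀ (L : Type) [Field L] [Fintype L] [Algebra K L],
      Finite { g : Spec (CommRingCat.of L) ⟶ X //
        g ≫ f = Spec.map (CommRingCat.ofHom (algebraMap K L)) } ∧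
      Nat.card { g : Spec (CommRingCat.of L) ⟶ X //
        g ≫ f = Spec.map (CommRingCat.ofHom (algebraMap K L)) } ≤ B * (Fintype.card L) ^ d := by
  classical
  have hc : CompactSpace X := QuasiCompact.compactSpace_of_compactSpace f
  choose R j hj hx using zr_chart X
  obtain ⟨t, -, ht⟩ := (isCompact_univ (X := X)).elim_nhds_subcover (fun x => Set.range (j x))
    (fun x _ => (j x).isOpenEmbedding.isOpen_range.mem_nhds (hx x))
  have hper : ∀ x : X, ∃ B : ℕ, ∀ (L : Type) [Field L] [Fintype L] [Algebra K L],
      Finite { g : { g : Spec (CommRingCat.of L) ⟶ X //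
        g ≫ f = Spec.map (CommRingCat.ofHom (algebraMap K L)) } // ∃ h, h ≫ j x = g.1 } ∧
      Nat.card { g : { g : Spec (CommRingCat.of L) ⟶ X //
        g ≫ f = Spec.map (CommRingCat.ofHom (algebraMap K L)) } // ∃ h, h ≫ j x = g.1 } ≤ B * (Fintype.card L) ^ d := by
    intro x
    obtain ⟨φ, hft, hφ⟩ := zr_chart_alg f (j x)
    let _ : Algebra K (R x) := φ.toAlgebra
    have : Algebra.FiniteType K (R x) := hft
    obtain ⟨B, hB⟩ := zr_upper_alg (K := K) (A := R x) d ((zr_chart_dim_le (j x)).trans hd)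
    refine ⟨B, fun L _ _ _ => ?_⟩
    obtain ⟨Ψ, _, hΨ⟩ := zr_alg_to_pts f (j x) hφ L
    have : Finite (R x →ₐ[K] L) := zr_finite_hom
    choose α hα using hΨ
    have hinj : Function.Injective (fun g : { g : { g : Spec (CommRingCat.of L) ⟶ X //
        g ≫ f = Spec.map (CommRingCat.ofHom (algebraMap K L)) } // ∃ h, h ≫ j x = g.1 } => α g.1 g.2) := by
      intro g g' h
      apply Subtype.ext
      have h' : α g.1 g.2 = α g'.1 g'.2 := h
      rw [← hα g.1 g.2, ← hα g'.1 g'.2, h']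
    exact ⟨Finite.of_injective _ hinj, (Nat.card_le_card_of_injective _ hinj).trans (hB L)⟩
  choose B hB using hper
  refine ⟨∑ x : t, B x, fun L _ _ _ => ?_⟩
  let G := { g : Spec (CommRingCat.of L) ⟶ X //
        g ≫ f = Spec.map (CommRingCat.ofHom (algebraMap K L)) }
  let S : t → Type := fun x => { g : G // ∃ h, h ≫ j x = g.1 }
  have hS : ∀ x, Finite (S x) := fun x => (hB x L).1
  let Θ : (Σ x : t, S x) → G := fun p => p.2.1
  have hsurj : Function.Surjective Θ := by
    intro g
    have hsub : Subsingleton (Spec (CommRingCat.of L)) := inferInstanceAs (Subsingleton (PrimeSpectrum L))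
    let pt : Spec (CommRingCat.of L) := (⊥ : PrimeSpectrum L)
    have hp : g.1 pt ∈ ⋃ x ∈ t, Set.range (j x) := ht (Set.mem_univ _)
    simp only [Set.mem_iUnion] at hp
    obtain ⟨x, hxt, hp⟩ := hp
    have hr : Set.range g.1 ⊆ Set.range (j x) := by
      rintro _ ⟨z, rfl⟩
      rw [Subsingleton.elim z pt]; exact hp
    exact ⟨⟨⟨x, hxt⟩, ⟨g, IsOpenImmersion.lift (j x) g.1 hr, IsOpenImmersion.lift_fac _ _ _⟩⟩, rfl⟩
  refine ⟨Finite.of_surjective Θ hsurj, ?_⟩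
  calc Nat.card G ≤ Nat.card (Σ x : t, S x) := Nat.card_le_card_of_surjective Θ hsurj
    _ = ∑ x : t, Nat.card (S x) := Nat.card_sigma
    _ ≤ ∑ x : t, B x * (Fintype.card L) ^ d := Finset.sum_le_sum fun x _ => (hB x L).2
    _ = _ := by rw [Finset.sum_mul]

end

open AlgebraicGeometry CategoryTheory

/-- Let `X` be a nonempty reduced separated scheme of finite type over a finite field `K`
with `q` elements, whose underlying space has Krull dimension `d`.  For `v ≥ 1` let
`c v` be the number of `K`-morphisms `Spec L → X` for `L` a field extension of `K` of
degree `v` (this number is independent of the choice of `L`).  Then the radius of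
convergence of `∑_{v ≥ 1} (c v / v) t^v` equals `q^{-d}`:  the series converges
absolutely for `0 ≤ r < q^{-d}` and diverges for `r > q^{-d}`. -/
theorem radius_zeta_series_of_variety (q d : ℕ)
    (K : Type) [Field K] [Fintype K] (hK : Fintype.card K = q)
    (X : Scheme) (f : X ⟶ Spec (CommRingCat.of K))
    [IsReduced X] [IsSeparated f] [LocallyOfFiniteType f] [QuasiCompact f]
    (hne : Nonempty X)
    (hdim : topologicalKrullDim X = (d : ℕ∞))
    (c : ℕ → ℕ)
    (hc : ∀ v : ℕ, 1 ≤ v → ∀ (L : Type) [Field L] [Algebra K L],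
      Module.finrank K L = v →
      c v = Nat.card { g : Spec (CommRingCat.of L) ⟶ X //
        g ≫ f = Spec.map (CommRingCat.ofHom (algebraMap K L)) }) :
    (∀ r : ℝ, 0 ≤ r → r < (q : ℝ) ^ (-(d : ℤ)) →
      Summable fun v : ℕ => (c (v + 1) : ℝ) / (v + 1) * r ^ (v + 1)) ∧
    (∀ r : ℝ, (q : ℝ) ^ (-(d : ℤ)) < r →
      ¬ Summable fun v : ℕ => (c (v + 1) : ℝ) / (v + 1) * r ^ (v + 1)) := by
  have hq1 : 1 < q := hK ▸ Fintype.one_lt_card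
  have hq0 : (0:ℝ) < q := by exact_mod_cast (by omega : 0 < q)
  have hdim' : topologicalKrullDim X = (d : WithBot ℕ∞) := by rw [hdim]; rfl
  obtain ⟨B, hB⟩ := zr_scheme_upper f d hdim'.le
  have hqd : (0:ℝ) < (q:ℝ) ^ d := by positivity
  constructor
  · intro r hr0 hr
    rw [zpow_neg, zpow_natCast] at hr
    have hρ : (q:ℝ) ^ d * r < 1 := by
      calc (q:ℝ) ^ d * r < (q:ℝ) ^ d * ((q:ℝ) ^ d)⁻¹ := mul_lt_mul_of_pos_left hr hqd
        _ = 1 := mul_inv_cancel₀ hqd.ne'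
    have hρ0 : 0 ≤ (q:ℝ) ^ d * r := by positivity
    have hcv : ∀ v : ℕ, c (v + 1) ≤ B * (q ^ (v + 1)) ^ d := by
      intro v
      obtain ⟨L, _, _, _, h1, h2⟩ := zr_ext_exists K (v + 1) (by omega)
      rw [hc (v + 1) (by omega) L h1]
      refine (hB L).2.trans ?_
      rw [h2, Nat.card_eq_fintype_card, hK]
    have hsum : Summable fun v : ℕ => (B : ℝ) * ((q:ℝ) ^ d * r) ^ (v + 1) := by
      apply Summable.mul_left
      exact (summable_nat_add_iff 1).2 (summable_geometric_of_lt_one hρ0 hρ)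
    refine Summable.of_nonneg_of_le (fun v => by positivity) (fun v => ?_) hsum
    have h1 : (c (v + 1) : ℝ) ≤ B * ((q:ℝ) ^ (v + 1)) ^ d := by exact_mod_cast hcv v
    have h2 : (c (v + 1) : ℝ) / (v + 1) ≤ c (v + 1) := by
      apply div_le_self (by positivity)
      have : (0:ℝ) ≤ v := by positivity
      linarith
    calc (c (v + 1) : ℝ) / (v + 1) * r ^ (v + 1) ≤ (B * ((q:ℝ) ^ (v + 1)) ^ d) * r ^ (v + 1) :=
          mul_le_mul_of_nonneg_right (h2.trans h1) (by positivity)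
      _ = _ := by rw [mul_pow, ← pow_mul, ← pow_mul, mul_comm d (v + 1)]; ring
  · intro r hr hsum
    rw [zpow_neg, zpow_natCast] at hr
    have hr0 : 0 < r := lt_trans (by positivity) hr
    have hρ : 1 < (q:ℝ) ^ d * r := by
      calc (1:ℝ) = (q:ℝ) ^ d * ((q:ℝ) ^ d)⁻¹ := (mul_inv_cancel₀ hqd.ne').symm
        _ < _ := mul_lt_mul_of_pos_left hr hqd
    obtain ⟨m, hm, M, hM, v₀, hlow⟩ := zr_scheme_lower f d hdim'.ge
    have ht := hsum.tendsto_atTop_zero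
    have ht' : Filter.Tendsto (fun n : ℕ => (c n : ℝ) / n * r ^ n) Filter.atTop (nhds 0) := by
      rw [← Filter.tendsto_add_atTop_iff_nat 1]
      simpa using ht
    have hp := tendsto_pow_const_div_const_pow_of_one_lt 1 hρ
    have e1 := ht'.eventually (gt_mem_nhds (show (0:ℝ) < 1 by norm_num))
    have hM0 : (0:ℝ) < M := by exact_mod_cast hM
    have e2 := hp.eventually (gt_mem_nhds (show (0:ℝ) < 1 / M by positivity))
    obtain ⟨n₀, hn₀⟩ := Filter.eventually_atTop.1 (e1.and e2)
    obtain ⟨v, hv1, hv2, hv3⟩ : ∃ v, v₀ ≤ v ∧ n₀ ≤ v ∧ 1 ≤ v := ⟨v₀ + n₀ + 1, by omega, by omega, by omega⟩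
    obtain ⟨L, _, _, _, h1, h2⟩ := hlow v hv1
    have hmv : v ≤ m * v := Nat.le_mul_of_pos_left v hm
    have h3 := h2 (hB L).1
    rw [← hc (m * v) (by omega) L h1, Module.card_eq_pow_finrank (K := K), h1, hK] at h3
    obtain ⟨g1, g2⟩ := hn₀ (m * v) (by omega)
    set n := m * v with hn
    have hn0 : (0:ℝ) < n := by exact_mod_cast (by omega : 0 < n)
    have h4 : ((q:ℝ) ^ n) ^ d ≤ M * c n := by exact_mod_cast h3
    have h5 : ((q:ℝ) ^ d * r) ^ n ≤ M * c n * r ^ n := by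
      calc ((q:ℝ) ^ d * r) ^ n = ((q:ℝ) ^ n) ^ d * r ^ n := by
            rw [mul_pow, ← pow_mul, ← pow_mul, mul_comm d n]
        _ ≤ _ := mul_le_mul_of_nonneg_right h4 (by positivity)
    have hρn : 0 < ((q:ℝ) ^ d * r) ^ n := by positivity
    rw [pow_one, div_lt_div_iff₀ hρn hM0, one_mul] at g2
    have h6 : (c n : ℝ) * r ^ n < n := by
      rw [div_mul_eq_mul_div, div_lt_one hn0] at g1
      exact g1
    have h7 : M * (c n * r ^ n) < n * M := by
      rw [mul_comm (n:ℝ)]; exact mul_lt_mul_of_pos_left h6 hM0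
    have h8 : (M:ℝ) * c n * r ^ n = M * (c n * r ^ n) := by ring
    linarith
end

section
/- Let q be a prime power. The series exp(∑_{v≥1} t^v/(v(q^v − 1))) converges for all complex t with |t| < q, and the holomorphic function Z(t) it defines there extends to a meromorphic function on the whole complex plane which is holomorphic on ℂ ∖ {q^n : n ∈ ℤ, n ≥ 1} and has a simple pole at t = q^n for every integer n ≥ 1. -/
open Filter

noncomputable def bgmTerm (q : ℕ) (t : ℂ) (v : ℕ) : ℂ :=
  t ^ (v + 1) / ((v + 1) * ((q : ℂ) ^ (v + 1) - 1))

noncomputable def bgmG (q : ℕ) (t : ℂ) : ℂ := Complex.exp (∑' v : ℕ, bgmTerm q t v)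

noncomputable def bgmA (q N : ℕ) (t : ℂ) : ℂ :=
  bgmG q (t / (q : ℂ) ^ N) / ∏ i ∈ Finset.range N, (1 - t / (q : ℂ) ^ (i + 1))

lemma bgm_norm_le (q : ℕ) (hq : 2 ≤ q) (t : ℂ) (v : ℕ) :
    ‖bgmTerm q t v‖ ≤ 2 * (‖t‖ / q) ^ (v + 1) := by
  have hq' : (2 : ℝ) ≤ q := by exact_mod_cast hq
  have h1 : (2 : ℝ) ≤ (q : ℝ) ^ (v + 1) :=
    hq'.trans (le_self_pow₀ (by linarith) (by omega))
  have h2 : (q : ℝ) ^ (v + 1) / 2 ≤ ‖(q : ℂ) ^ (v + 1) - 1‖ := by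
    have := norm_sub_norm_le ((q : ℂ) ^ (v + 1)) 1
    simp only [norm_pow, Complex.norm_natCast, norm_one] at this
    linarith
  have h3 : (1 : ℝ) ≤ ‖((v : ℂ) + 1)‖ := by
    have : ((v : ℂ) + 1) = ((v + 1 : ℕ) : ℂ) := by push_cast; ring
    rw [this, Complex.norm_natCast]; push_cast
    have : (0 : ℝ) ≤ v := Nat.cast_nonneg v
    linarith
  have h4 : (q : ℝ) ^ (v + 1) / 2 ≤ ‖((v : ℂ) + 1)‖ * ‖(q : ℂ) ^ (v + 1) - 1‖ := by
    nlinarith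
  rw [bgmTerm, norm_div, norm_mul, norm_pow]
  calc _ ≤ ‖t‖ ^ (v + 1) / ((q : ℝ) ^ (v + 1) / 2) := by gcongr
    _ = _ := by rw [div_pow]; field_simp

lemma bgm_summable (q : ℕ) (hq : 2 ≤ q) (t : ℂ) (ht : ‖t‖ < q) : Summable (bgmTerm q t) := by
  have hq' : (2 : ℝ) ≤ q := by exact_mod_cast hq
  refine Summable.of_norm_bounded (g := fun v => 2 * (‖t‖ / q) ^ (v + 1)) ?_ (bgm_norm_le q hq t)
  have : Summable (fun v : ℕ => (‖t‖ / q) ^ v) :=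
    summable_geometric_of_lt_one (by positivity) ((div_lt_one (by linarith)).2 ht)
  exact ((summable_nat_add_iff 1).2 this).mul_left 2

lemma bgm_feq (q : ℕ) (hq : 2 ≤ q) (t : ℂ) (ht : ‖t‖ < q) :
    bgmG q t = bgmG q (t / q) / (1 - t / q) := by
  have hq' : (2 : ℝ) ≤ q := by exact_mod_cast hq
  have hq0 : (q : ℂ) ≠ 0 := by exact_mod_cast (by omega : q ≠ 0)
  have hz : ‖t / (q : ℂ)‖ < 1 := by
    rw [norm_div, Complex.norm_natCast]; exact (div_lt_one (by linarith)).2 ht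
  have hs1 := bgm_summable q hq t ht
  have hs2 := bgm_summable q hq (t / q) (by linarith)
  have hl := (hasSum_nat_add_iff' 1).2 (Complex.hasSum_taylorSeries_neg_log hz)
  have hne : (1 - t / (q : ℂ)) ≠ 0 := by
    intro h
    have : t / (q : ℂ) = 1 := (sub_eq_zero.1 h).symm
    rw [this] at hz; simp at hz
  have key : ∀ v, bgmTerm q t v = bgmTerm q (t / q) v + (t / (q : ℂ)) ^ (v + 1) / ((v + 1 : ℕ) : ℂ) := by
    intro v
    have h1 : (q : ℂ) ^ (v + 1) - 1 ≠ 0 := by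
      rw [sub_ne_zero]
      have : q ^ (v + 1) ≠ 1 := by
        have := Nat.one_lt_pow (n := v + 1) (by omega) (show 1 < q by omega)
        omega
      exact_mod_cast this
    have h2 : (v : ℂ) + 1 ≠ 0 := by exact_mod_cast Nat.succ_ne_zero v
    unfold bgmTerm
    push_cast
    rw [div_pow]
    have h3 : (q : ℂ) ^ (v + 1) ≠ 0 := pow_ne_zero _ hq0
    generalize (q : ℂ) ^ (v + 1) = Q at *
    field_simp
    ring
  unfold bgmG
  rw [tsum_congr key, hs2.tsum_add hl.summable, hl.tsum_eq, Complex.exp_add]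
  simp only [Finset.range_one, Finset.sum_singleton, Nat.cast_zero, div_zero, sub_zero]
  rw [Complex.exp_neg, Complex.exp_log hne, ← div_eq_mul_inv]

lemma bgmA_succ (q : ℕ) (hq : 2 ≤ q) (N : ℕ) (t : ℂ) (ht : ‖t‖ < (q : ℝ) ^ (N + 1)) :
    bgmA q (N + 1) t = bgmA q N t := by
  have hq' : (2 : ℝ) ≤ q := by exact_mod_cast hq
  have h : ‖t / (q : ℂ) ^ N‖ < q := by
    rw [norm_div, norm_pow, Complex.norm_natCast, div_lt_iff₀ (by positivity)]
    rwa [pow_succ'] at ht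
  unfold bgmA
  rw [bgm_feq q hq _ h, Finset.prod_range_succ, div_div, div_div, ← pow_succ, mul_comm]

lemma bgmA_le (q : ℕ) (hq : 2 ≤ q) (N M : ℕ) (hNM : N ≤ M) (t : ℂ)
    (ht : ‖t‖ < (q : ℝ) ^ (N + 1)) : bgmA q M t = bgmA q N t := by
  have hq' : (2 : ℝ) ≤ q := by exact_mod_cast hq
  induction M, hNM using Nat.le_induction with
  | base => rfl
  | succ M h ih =>
    rw [bgmA_succ q hq M t (ht.trans_le (pow_le_pow_right₀ (by linarith) (by omega))), ih]

lemma bgmA_eq (q : ℕ) (hq : 2 ≤ q) (N M : ℕ) (t : ℂ)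
    (hN : ‖t‖ < (q : ℝ) ^ (N + 1)) (hM : ‖t‖ < (q : ℝ) ^ (M + 1)) :
    bgmA q M t = bgmA q N t := by
  rcases le_total N M with h | h
  · exact bgmA_le q hq N M h t hN
  · exact (bgmA_le q hq M N h t hM).symm

lemma bgmG_analytic (q : ℕ) (hq : 2 ≤ q) (t : ℂ) (ht : ‖t‖ < 1) : AnalyticAt ℂ (bgmG q) t := by
  have hq' : (2 : ℝ) ≤ q := by exact_mod_cast hq
  have hd : DifferentiableOn ℂ (fun t => ∑' v : ℕ, bgmTerm q t v) (Metric.ball 0 1) := by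
    refine Complex.differentiableOn_tsum_of_summable_norm (u := fun v => 2 * (1 / (q : ℝ)) ^ (v + 1))
      ?_ ?_ Metric.isOpen_ball ?_
    · have : Summable (fun v : ℕ => (1 / (q : ℝ)) ^ v) :=
        summable_geometric_of_lt_one (by positivity) ((div_lt_one (by linarith)).2 (by linarith))
      exact ((summable_nat_add_iff 1).2 this).mul_left 2
    · intro v
      unfold bgmTerm
      fun_prop
    · intro v w hw
      have hw : ‖w‖ < 1 := by simpa using hw
      refine (bgm_norm_le q hq w v).trans ?_
      gcongr
  exact (hd.analyticAt (Metric.isOpen_ball.mem_nhds (by simpa using ht))).cexp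

lemma bgm_lt_pow (q : ℕ) (hq : 2 ≤ q) (r : ℝ) (N : ℕ) (h : r ≤ N) : r < (q : ℝ) ^ N := by
  have : N < q ^ N := Nat.lt_pow_self (by omega)
  exact h.trans_lt (by exact_mod_cast this)

noncomputable def bgmF (q : ℕ) (t : ℂ) : ℂ := bgmA q ⌈‖t‖⌉₊ t

lemma bgmF_eq (q : ℕ) (hq : 2 ≤ q) (M : ℕ) (t : ℂ) (hM : ‖t‖ < (q : ℝ) ^ (M + 1)) :
    bgmF q t = bgmA q M t := by
  refine bgmA_eq q hq _ _ t hM ?_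
  exact bgm_lt_pow q hq _ _ ((Nat.le_ceil _).trans (by push_cast; linarith))

lemma bgmF_local (q : ℕ) (hq : 2 ≤ q) (z : ℂ) : ∃ M : ℕ, ‖z‖ < (q : ℝ) ^ M ∧
    AnalyticAt ℂ (fun t => bgmG q (t / (q : ℂ) ^ M)) z ∧ bgmF q =ᶠ[nhds z] bgmA q M := by
  have hq' : (2 : ℝ) ≤ q := by exact_mod_cast hq
  have hz : ‖z‖ < (q : ℝ) ^ ⌈‖z‖⌉₊ := bgm_lt_pow q hq _ _ (Nat.le_ceil _)
  refine ⟨⌈‖z‖⌉₊, hz, ?_, ?_⟩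
  · refine AnalyticAt.fun_comp (g := bgmG q) (f := fun t : ℂ => t / (q : ℂ) ^ ⌈‖z‖⌉₊)
      (bgmG_analytic q hq (z / (q : ℂ) ^ ⌈‖z‖⌉₊) ?_)
      (by simp only [div_eq_mul_inv]; fun_prop)
    rw [norm_div, norm_pow, Complex.norm_natCast]
    exact (div_lt_one (by positivity)).2 hz
  · have : ∀ᶠ t in nhds z, ‖t‖ < (q : ℝ) ^ ⌈‖z‖⌉₊ :=
      continuous_norm.continuousAt.eventually_lt continuousAt_const hz
    filter_upwards [this] with t ht
    exact bgmF_eq q hq _ t (ht.trans_le (pow_le_pow_right₀ (by linarith) (by omega)))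

/-- For a prime power `q`, the series `∑_{v ≥ 1} t^v / (v (q^v - 1))` converges for all
complex `|t| < q`, and the holomorphic function
`Z(t) = exp (∑_{v ≥ 1} t^v / (v (q^v - 1)))` defined there (the zeta function of `B𝔾ₘ`)
extends to a meromorphic function on all of `ℂ` which is analytic on
`ℂ ∖ {q^n : n ≥ 1}` and has a simple pole at `t = q^n` for every integer `n ≥ 1`. -/
theorem zeta_BGm_meromorphic (q : ℕ) (hq : IsPrimePow q) :
    ∃ F : ℂ → ℂ,
      (∀ t : ℂ, ‖t‖ < (q : ℝ) →
        Summable (fun v : ℕ => t ^ (v + 1) / ((v + 1) * ((q : ℂ) ^ (v + 1) - 1))) ∧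
        F t = Complex.exp (∑' v : ℕ, t ^ (v + 1) / ((v + 1) * ((q : ℂ) ^ (v + 1) - 1)))) ∧
      MeromorphicOn F Set.univ ∧
      (∀ z : ℂ, (∀ n : ℕ, 1 ≤ n → z ≠ (q : ℂ) ^ n) → AnalyticAt ℂ F z) ∧
      (∀ n : ℕ, 1 ≤ n → ∃ g : ℂ → ℂ, AnalyticAt ℂ g ((q : ℂ) ^ n) ∧
        g ((q : ℂ) ^ n) ≠ 0 ∧
        ∀ᶠ z in nhdsWithin ((q : ℂ) ^ n) {((q : ℂ) ^ n)}ᶜ,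
          F z = g z / (z - (q : ℂ) ^ n)) := by
  have hq2 : 2 ≤ q := hq.two_le
  have hq0 : (q : ℂ) ≠ 0 := by exact_mod_cast (by omega : q ≠ 0)
  refine ⟨bgmF q, ?_, ?_, ?_, ?_⟩
  · intro t ht
    refine ⟨bgm_summable q hq2 t ht, ?_⟩
    rw [bgmF_eq q hq2 0 t (by simpa using ht)]
    simp [bgmA, bgmG, bgmTerm]
  · intro z _
    obtain ⟨M, -, hG, hF⟩ := bgmF_local q hq2 z
    refine MeromorphicAt.congr ?_ (hF.symm.filter_mono nhdsWithin_le_nhds)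
    refine hG.meromorphicAt.div (AnalyticAt.meromorphicAt ?_)
    fun_prop
  · intro z hz
    obtain ⟨M, -, hG, hF⟩ := bgmF_local q hq2 z
    refine AnalyticAt.congr ?_ hF.symm
    refine hG.div (by fun_prop) ?_
    rw [Finset.prod_ne_zero_iff]
    intro i _ h
    apply hz (i + 1) (by omega)
    have := (sub_eq_zero.1 h).symm
    rwa [div_eq_one_iff_eq (pow_ne_zero _ hq0)] at this
  · intro n hn
    obtain ⟨M, hM, hG, hF⟩ := bgmF_local q hq2 ((q : ℂ) ^ n)
    obtain ⟨k, rfl⟩ : ∃ k, n = k + 1 := ⟨n - 1, by omega⟩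
    have hkM : k + 1 < M := by
      rw [norm_pow, Complex.norm_natCast] at hM
      have hM' : q ^ (k + 1) < q ^ M := by exact_mod_cast hM
      exact (Nat.pow_lt_pow_iff_right (by omega)).1 hM'
    have hP : ∏ i ∈ (Finset.range M).erase k, (1 - (q : ℂ) ^ (k + 1) / (q : ℂ) ^ (i + 1)) ≠ 0 := by
      rw [Finset.prod_ne_zero_iff]
      intro i hi h
      have := (sub_eq_zero.1 h).symm
      rw [div_eq_one_iff_eq (pow_ne_zero _ hq0)] at this
      have h' : q ^ (k + 1) = q ^ (i + 1) := by exact_mod_cast this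
      have := Nat.pow_right_injective hq2 h'
      exact (Finset.mem_erase.1 hi).1 (by omega)
    refine ⟨fun z => (-(q : ℂ) ^ (k + 1)) * (bgmG q (z / (q : ℂ) ^ M) /
      ∏ i ∈ (Finset.range M).erase k, (1 - z / (q : ℂ) ^ (i + 1))), ?_, ?_, ?_⟩
    · exact analyticAt_const.mul (hG.div (by fun_prop) hP)
    · exact mul_ne_zero (neg_ne_zero.2 (pow_ne_zero _ hq0)) (div_ne_zero (Complex.exp_ne_zero _) hP)
    · filter_upwards [hF.filter_mono nhdsWithin_le_nhds, self_mem_nhdsWithin] with z hz hne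
      have hne' : z - (q : ℂ) ^ (k + 1) ≠ 0 := sub_ne_zero.2 hne
      have hQ : (q : ℂ) ^ (k + 1) ≠ 0 := pow_ne_zero _ hq0
      rw [hz, bgmA, ← Finset.mul_prod_erase _ _ (Finset.mem_range.2 (by omega : k < M))]
      have e : 1 - z / (q : ℂ) ^ (k + 1) = (z - (q : ℂ) ^ (k + 1)) * (-(q : ℂ) ^ (k + 1))⁻¹ := by
        field_simp
        ring
      rw [e]
      simp only [div_eq_mul_inv, mul_inv, inv_inv]
      ring
end
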